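/- Let H₁, H₂ ∈ (0,1). Let X = (X(t))_{t∈ℝ} be a centered Gaussian process with continuous sample paths and covariance E[X(t)X(s)] = (1/2)(|s|^{2H₂} + |t|^{2H₂} − |t − s|^{2H₂}) for all s, t ∈ ℝ, and let Y = (Y(t))_{t∈[0,1]} be a continuous modification of a fractional Brownian motion with Hurst parameter H₁, independent of X. Let c(H₁), c(H₂) > 0 be constants such that −log P(sup_{t∈[0,1]} |Y(t)| ≤ ε) ∼ c(H₁) ε^{−1/H₁} and −log P(sup_{t∈[0,1]} |X(t)| ≤ ε) ∼ c(H₂) ε^{−1/H₂} as ε → 0. Then −log P(sup_{t∈[0,1]} |X(Y(t))| ≤ ε) ∼ (1 + 1/H₁) · [c(H₁)^{H₁} · 2 H₁ c(H₂)]^{1/(1+H₁)} · ε^{−1/(H₂(1+H₁))} as ε → 0. -/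

import Mathlib

open MeasureTheory ProbabilityTheory Filter Set
open scoped NNReal ENNReal

noncomputable section

/-- `f ∼ g` as `ε → 0⁺`: the ratio `f/g` tends to `1`. -/
def strongEquiv (f g : ℝ → ℝ) : Prop :=
  Filter.Tendsto (fun ε => f ε / g ε) (nhdsWithin 0 (Set.Ioi 0)) (nhds 1)

variable {Ω : Type*} [MeasureSpace Ω]

/-- `X` is a 'true' two-sidedly defined fractional Brownian motion with Hurst index `H`:
a centered Gaussian process indexed by `ℝ` with covariance
`(1/2)(|s|^{2H} + |t|^{2H} - |t-s|^{2H})` (characterized through one-dimensional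
distributions of linear combinations). -/
def IsTrueFBM (H : ℝ) (X : ℝ → Ω → ℝ) : Prop :=
  ∀ (n : ℕ) (t : Fin n → ℝ) (a : Fin n → ℝ),
    Measure.map (fun ω => ∑ i, a i * X (t i) ω) ℙ =
      gaussianReal 0 (∑ i, ∑ j, a i * a j *
        (1/2 * (|t i| ^ (2*H) + |t j| ^ (2*H) - |t i - t j| ^ (2*H)))).toNNReal

/-- `Y` has, on the time set `s ⊆ [0,∞)`, the finite-dimensional distributions of a
fractional Brownian motion with Hurst parameter `H`. -/
def HasFBMFdds (H : ℝ) (s : Set ℝ) (Y : ℝ → Ω → ℝ) : Prop :=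
  ∀ (n : ℕ) (t : Fin n → ℝ), (∀ i, t i ∈ s) → ∀ a : Fin n → ℝ,
    Measure.map (fun ω => ∑ i, a i * Y (t i) ω) ℙ =
      gaussianReal 0 (∑ i, ∑ j, a i * a j *
        (1/2 * ((t i) ^ (2*H) + (t j) ^ (2*H) - |t i - t j| ^ (2*H)))).toNNReal

/-- One-dimensional Brunn–Minkowski inequality for midpoints. -/
lemma volume_add_le_of_midpoint_mem {A B C : Set ℝ} (hA : MeasurableSet A) (hB : MeasurableSet B)
    (hAn : A.Nonempty) (hBn : B.Nonempty) (h : ∀ x ∈ A, ∀ y ∈ B, (1 / 2 : ℝ) * (x + y) ∈ C) :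
    volume A + volume B ≤ 2 * volume C := by
  have key : ∀ K L : Set ℝ, IsCompact K → IsCompact L → K.Nonempty → L.Nonempty → K ⊆ A → L ⊆ B →
      volume K + volume L ≤ 2 * volume C := by
    intro K L hK hL hKn hLn hKA hLB
    obtain ⟨k, hkK, hk⟩ := hK.exists_isGreatest hKn
    obtain ⟨l, hlL, hl⟩ := hL.exists_isLeast hLn
    have scale : ∀ (S : Set ℝ) (c : ℝ), volume S = 2 * volume ((fun z => 2 * z - c) ⁻¹' S) := by
      intro S c
      have : (fun z : ℝ => 2 * z - c) ⁻¹' S = (fun z => 2 * z) ⁻¹' ((fun z => z + (-c)) ⁻¹' S) := by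
        ext z; simp [sub_eq_add_neg]
      rw [this, Real.volume_preimage_mul_left two_ne_zero, measure_preimage_add_right, ← mul_assoc]
      have : (2 : ℝ≥0∞) * ENNReal.ofReal |2⁻¹| = 1 := by
        rw [abs_of_pos (by norm_num), ENNReal.ofReal_inv_of_pos (by norm_num)]
        simpa using ENNReal.mul_inv_cancel (a := 2) (by simp) (by simp)
      rw [this, one_mul]
    rw [scale K l, scale L k, ← mul_add]
    gcongr
    have hdisj : AEDisjoint volume ((fun z => 2 * z - l) ⁻¹' K) ((fun z => 2 * z - k) ⁻¹' L) := by
      refine measure_mono_null (t := {(k + l) / 2}) ?_ (by simp)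
      rintro z ⟨hz1, hz2⟩
      have h1 := hk hz1
      have h2 := hl hz2
      simp only [mem_singleton_iff]
      linarith
    rw [← measure_union₀ ?_ hdisj]
    · refine measure_mono ?_
      rintro z (hz | hz)
      · convert h _ (hKA hz) _ (hLB hlL) using 1
        ring
      · convert h _ (hKA hkK) _ (hLB hz) using 1
        ring
    · exact (hL.measurableSet.preimage (by fun_prop)).nullMeasurableSet
  obtain ⟨a, ha⟩ := hAn
  obtain ⟨b, hb⟩ := hBn
  have bound : ∀ K ⊆ A, IsCompact K → ∀ L ⊆ B, IsCompact L →
      volume K + volume L ≤ 2 * volume C := fun K hKA hK L hLB hL =>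
    (add_le_add (measure_mono (subset_insert a K)) (measure_mono (subset_insert b L))).trans
      (key _ _ (hK.insert a) (hL.insert b) (insert_nonempty _ _) (insert_nonempty _ _)
        (insert_subset ha hKA) (insert_subset hb hLB))
  have inner : ∀ S : Set ℝ, MeasurableSet S →
      volume S = ⨆ (K) (_ : K ⊆ S ∧ IsCompact K), volume K := by
    intro S hS
    simp only [iSup_and]
    exact hS.measure_eq_iSup_isCompact volume
  rw [inner A hA, inner B hB]
  exact ENNReal.biSup_add_biSup_le' ⟨∅, empty_subset _, isCompact_empty⟩
    ⟨∅, empty_subset _, isCompact_empty⟩ fun K hK L hL => bound K hK.1 hK.2 L hL.1 hL.2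

lemma ENNReal.mul_le_sq_of_add_le {a b c : ℝ≥0∞} (h : a + b ≤ 2 * c) : a * b ≤ c ^ 2 := by
  rcases eq_or_ne c ∞ with rfl | hc
  · simp
  have h2 : 2 * c ≠ ∞ := ENNReal.mul_ne_top (by simp) hc
  have hab := ne_top_of_le_ne_top h2 h
  lift a to ℝ≥0 using (ENNReal.add_ne_top.1 hab).1
  lift b to ℝ≥0 using (ENNReal.add_ne_top.1 hab).2
  lift c to ℝ≥0 using hc
  norm_cast at *
  rw [← NNReal.coe_le_coe] at *
  push_cast at *
  nlinarith [sq_nonneg ((a : ℝ) - b), a.2, b.2, c.2]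

/-- One-dimensional Prékopa–Leindler inequality with equal weights, for bounded functions. -/
lemma prekopa_leindler_real {f g h : ℝ → ℝ} (hf : Measurable f) (hg : Measurable g)
    (hf0 : ∀ x, 0 ≤ f x) (hg0 : ∀ x, 0 ≤ g x) (hh0 : ∀ x, 0 ≤ h x) (hh : Measurable h)
    (hfb : BddAbove (range f)) (hgb : BddAbove (range g))
    (H : ∀ x y, f x * g y ≤ h ((1 / 2 : ℝ) * (x + y)) ^ 2) :
    (∫⁻ x, ENNReal.ofReal (f x)) * (∫⁻ x, ENNReal.ofReal (g x)) ≤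
      (∫⁻ x, ENNReal.ofReal (h x)) ^ 2 := by
  set a := ⨆ x, f x with ha
  set b := ⨆ x, g x with hb
  have hfa : ∀ x, f x ≤ a := le_ciSup hfb
  have hgb' : ∀ x, g x ≤ b := le_ciSup hgb
  rcases (hf0 0 |>.trans (hfa 0)).eq_or_lt with ha0 | ha0
  · have : ∀ x, f x = 0 := fun x => le_antisymm (by rw [ha0]; exact hfa x) (hf0 x)
    simp [this]
  rcases (hg0 0 |>.trans (hgb' 0)).eq_or_lt with hb0 | hb0
  · have : ∀ x, g x = 0 := fun x => le_antisymm (by rw [hb0]; exact hgb' x) (hg0 x)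
    simp [this]
  set c := √(a * b) with hc
  have hc0 : 0 < c := Real.sqrt_pos.2 (mul_pos ha0 hb0)
  have hcc : c ^ 2 = a * b := Real.sq_sqrt (mul_pos ha0 hb0).le
  have layer : ∀ u : ℝ → ℝ, (∀ x, 0 ≤ u x) → Measurable u → ∀ m, 0 < m →
      ∫⁻ x, ENNReal.ofReal (u x) =
        ENNReal.ofReal m * ∫⁻ t in Ioi (0 : ℝ), volume {x | t < u x / m} := by
    intro u hu0 hu m hm
    rw [← lintegral_eq_lintegral_meas_lt _ (ae_of_all _ fun x => div_nonneg (hu0 x) hm.le)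
      (by fun_prop), ← lintegral_const_mul _ (by fun_prop)]
    refine lintegral_congr fun x => ?_
    rw [← ENNReal.ofReal_mul hm.le, mul_div_cancel₀ _ hm.ne']
  have restrict : ∀ u : ℝ → ℝ, (∀ x, u x ≤ 1) →
      ∫⁻ t in Ioi (0 : ℝ), volume {x | t < u x} = ∫⁻ t in Ioo (0 : ℝ) 1, volume {x | t < u x} := by
    intro u hu
    rw [← Ioo_union_Ici_eq_Ioi (zero_lt_one' ℝ), lintegral_union measurableSet_Ici]
    · rw [setLIntegral_congr_fun (g := fun _ => 0) measurableSet_Ici]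
      · simp
      · intro t ht
        have : {x | t < u x} = ∅ := by
          ext x; simpa using (hu x).trans ht
        simp [this]
    · rw [Set.disjoint_left]
      rintro x ⟨_, h1⟩ h2
      exact absurd h2 (not_le.2 h1)
  rw [layer f hf0 hf a ha0, layer g hg0 hg b hb0, layer h hh0 hh c hc0, mul_mul_mul_comm,
    mul_pow, ← ENNReal.ofReal_mul ha0.le, ← ENNReal.ofReal_pow hc0.le, hcc]
  gcongr
  rw [restrict (fun x => f x / a) fun x => (div_le_one ha0).2 (hfa x),
    restrict (fun x => g x / b) fun x => (div_le_one hb0).2 (hgb' x)]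
  apply ENNReal.mul_le_sq_of_add_le
  have meas : ∀ u : ℝ → ℝ, Measurable fun t => volume {x | t < u x} := fun u =>
    Antitone.measurable fun s t hst => measure_mono fun x hx => lt_of_le_of_lt hst hx
  rw [← lintegral_add_left (meas _), ← lintegral_const_mul _ (meas _)]
  refine (setLIntegral_mono' measurableSet_Ioo fun t ht => ?_).trans
    (lintegral_mono_set Ioo_subset_Ioi_self)
  refine volume_add_le_of_midpoint_mem (measurableSet_lt measurable_const (by fun_prop))
    (measurableSet_lt measurable_const (by fun_prop)) ?_ ?_ ?_
  · obtain ⟨x, hx⟩ := exists_lt_of_lt_ciSup (show t * a < ⨆ x, f x by nlinarith [ht.2])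
    exact ⟨x, (lt_div_iff₀ ha0).2 hx⟩
  · obtain ⟨x, hx⟩ := exists_lt_of_lt_ciSup (show t * b < ⨆ x, g x by nlinarith [ht.2])
    exact ⟨x, (lt_div_iff₀ hb0).2 hx⟩
  · intro x hx y hy
    simp only [mem_ofPred_eq] at hx hy ⊢
    rw [lt_div_iff₀ ha0] at hx
    rw [lt_div_iff₀ hb0] at hy
    rw [lt_div_iff₀ hc0]
    refine lt_of_pow_lt_pow_left₀ 2 (hh0 _) (lt_of_lt_of_le ?_ (H x y))
    rw [mul_pow, hcc]
    calc t ^ 2 * (a * b) = (t * a) * (t * b) := by ring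
      _ < f x * g y := mul_lt_mul'' hx hy (mul_pos ht.1 ha0).le (mul_pos ht.1 hb0).le

/-- A measure satisfies the midpoint Prékopa–Leindler inequality for functions bounded by `1`. -/
def IsMidpointLogConcave {E : Type*} [AddCommGroup E] [Module ℝ E] [MeasurableSpace E]
    (μ : Measure E) : Prop :=
  ∀ f g h : E → ℝ≥0∞, Measurable f → Measurable g → Measurable h →
    (∀ x, f x ≤ 1) → (∀ x, g x ≤ 1) → (∀ x, h x ≤ 1) →
    (∀ x y, f x * g y ≤ h ((1 / 2 : ℝ) • (x + y)) ^ 2) →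
    (∫⁻ x, f x ∂μ) * (∫⁻ x, g x ∂μ) ≤ (∫⁻ x, h x ∂μ) ^ 2

namespace IsMidpointLogConcave

variable {E F : Type*} [AddCommGroup E] [Module ℝ E] [MeasurableSpace E]
  [AddCommGroup F] [Module ℝ F] [MeasurableSpace F]

lemma map {μ : Measure E} (hμ : IsMidpointLogConcave μ) (φ : E →ₗ[ℝ] F) (hφ : Measurable φ) :
    IsMidpointLogConcave (μ.map φ) := by
  intro f g h hf hg hh hf1 hg1 hh1 H
  rw [lintegral_map hf hφ, lintegral_map hg hφ, lintegral_map hh hφ]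
  refine hμ _ _ _ (hf.comp hφ) (hg.comp hφ) (hh.comp hφ) (fun _ => hf1 _) (fun _ => hg1 _)
    (fun _ => hh1 _) fun x y => ?_
  simpa using H (φ x) (φ y)

lemma prod {μ : Measure E} {ν : Measure F} [IsProbabilityMeasure μ] [IsProbabilityMeasure ν]
    (hμ : IsMidpointLogConcave μ) (hν : IsMidpointLogConcave ν) :
    IsMidpointLogConcave (μ.prod ν) := by
  intro f g h hf hg hh hf1 hg1 hh1 H
  rw [lintegral_prod _ hf.aemeasurable, lintegral_prod _ hg.aemeasurable,
    lintegral_prod _ hh.aemeasurable]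
  have le_one : ∀ u : E × F → ℝ≥0∞, (∀ z, u z ≤ 1) → ∀ x, ∫⁻ y, u (x, y) ∂ν ≤ 1 :=
    fun u hu x => (lintegral_mono fun y => hu (x, y)).trans (by simp)
  refine hμ _ _ _ hf.lintegral_prod_right' hg.lintegral_prod_right' hh.lintegral_prod_right'
    (le_one f hf1) (le_one g hg1) (le_one h hh1) fun x x' => ?_
  exact hν _ _ _ (by fun_prop) (by fun_prop) (by fun_prop) (fun _ => hf1 _) (fun _ => hg1 _)
    (fun _ => hh1 _) fun y y' => H (x, y) (x', y')

end IsMidpointLogConcave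

lemma isMidpointLogConcave_gaussianReal : IsMidpointLogConcave (gaussianReal 0 1) := by
  intro f g h hf hg hh hf1 hg1 hh1 H
  rw [gaussianReal_of_var_ne_zero _ one_ne_zero]
  have conv : ∀ u : ℝ → ℝ≥0∞, Measurable u → (∀ x, u x ≤ 1) →
      ∫⁻ x, u x ∂(volume.withDensity (gaussianPDF 0 1)) =
        ∫⁻ x, ENNReal.ofReal (gaussianPDFReal 0 1 x * (u x).toReal) := by
    intro u hu hu1
    rw [lintegral_withDensity_eq_lintegral_mul _ (measurable_gaussianPDF 0 1) hu]
    refine lintegral_congr fun x => ?_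
    rw [Pi.mul_apply, ENNReal.ofReal_mul (gaussianPDFReal_nonneg 0 1 x),
      ENNReal.ofReal_toReal (ne_top_of_le_ne_top ENNReal.one_ne_top (hu1 x)), gaussianPDF]
  have nonneg : ∀ (u : ℝ → ℝ≥0∞) x, 0 ≤ gaussianPDFReal 0 1 x * (u x).toReal :=
    fun u x => mul_nonneg (gaussianPDFReal_nonneg 0 1 x) ENNReal.toReal_nonneg
  have le_one : ∀ {u : ℝ → ℝ≥0∞}, (∀ x, u x ≤ 1) → ∀ x, (u x).toReal ≤ 1 :=
    fun hu x => by simpa using ENNReal.toReal_mono ENNReal.one_ne_top (hu x)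
  have bdd : ∀ u : ℝ → ℝ≥0∞, (∀ x, u x ≤ 1) →
      BddAbove (range fun x => gaussianPDFReal 0 1 x * (u x).toReal) := by
    rintro u hu
    refine ⟨(√(2 * Real.pi * (1 : ℝ≥0)))⁻¹, ?_⟩
    rintro _ ⟨x, rfl⟩
    refine (mul_le_of_le_one_right (gaussianPDFReal_nonneg 0 1 x) (le_one hu x)).trans ?_
    refine mul_le_of_le_one_right (by positivity) (Real.exp_le_one_iff.2 ?_)
    exact div_nonpos_of_nonpos_of_nonneg (neg_nonpos.2 (sq_nonneg _)) (by positivity)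
  rw [conv f hf hf1, conv g hg hg1, conv h hh hh1]
  have hpdf := measurable_gaussianPDFReal 0 1
  refine prekopa_leindler_real (by fun_prop) (by fun_prop) (nonneg f) (nonneg g) (nonneg h)
    (by fun_prop) (bdd f hf1) (bdd g hg1) fun x y => ?_
  have h1 : (f x).toReal * (g y).toReal ≤ (h ((1 / 2 : ℝ) * (x + y))).toReal ^ 2 := by
    rw [← ENNReal.toReal_mul, ← ENNReal.toReal_pow]
    exact ENNReal.toReal_mono
      (ENNReal.pow_ne_top (ne_top_of_le_ne_top ENNReal.one_ne_top (hh1 _))) (H x y)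
  have h2 : gaussianPDFReal 0 1 x * gaussianPDFReal 0 1 y ≤
      gaussianPDFReal 0 1 ((1 / 2 : ℝ) * (x + y)) ^ 2 := by
    simp only [gaussianPDFReal, sub_zero, NNReal.coe_one, mul_one]
    rw [mul_mul_mul_comm, ← Real.exp_add, mul_pow, ← sq, ← Real.exp_nat_mul]
    gcongr
    push_cast
    nlinarith [sq_nonneg (x - y)]
  rw [mul_mul_mul_comm, mul_pow]
  exact mul_le_mul h2 h1 (by positivity) (by positivity)

lemma isMidpointLogConcave_pi_gaussianReal (n : ℕ) :
    IsMidpointLogConcave (Measure.pi fun _ : Fin n => gaussianReal 0 1) := by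
  induction n with
  | zero =>
    intro f g h hf hg hh hf1 hg1 hh1 H
    rw [Measure.pi_of_empty _ 0, lintegral_dirac' _ hf, lintegral_dirac' _ hg,
      lintegral_dirac' _ hh]
    simpa using H 0 0
  | succ n ih =>
    have mp := (measurePreserving_piFinSuccAbove
      (fun _ : Fin (n + 1) => gaussianReal 0 1) 0).symm
    rw [← mp.map_eq]
    let φ : ℝ × (Fin n → ℝ) →ₗ[ℝ] (Fin (n + 1) → ℝ) :=
      { toFun := fun z => (MeasurableEquiv.piFinSuccAbove (fun _ : Fin (n + 1) => ℝ) 0).symm z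
        map_add' := fun x y => by
          ext i; refine Fin.cases ?_ (fun j => ?_) i <;> simp [MeasurableEquiv.piFinSuccAbove]
        map_smul' := fun c x => by
          ext i; refine Fin.cases ?_ (fun j => ?_) i <;> simp [MeasurableEquiv.piFinSuccAbove] }
    exact (isMidpointLogConcave_gaussianReal.prod ih).map φ (MeasurableEquiv.measurable _)

open scoped MatrixOrder in
lemma isMidpointLogConcave_of_isGaussian {n : ℕ} {ν : Measure (EuclideanSpace ℝ (Fin n))}
    [IsGaussian ν] (h0 : ν[id] = 0) : IsMidpointLogConcave ν := by
  let B := (covarianceBilin ν).toBilinForm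
  let b := (EuclideanSpace.basisFun (Fin n) ℝ).toBasis
  let S := LinearMap.BilinForm.toMatrix b B
  have hS : S.PosSemidef := by
    refine Matrix.posSemidef_iff_dotProduct_mulVec.2 ⟨?_, fun x => ?_⟩
    · ext i j
      simp only [Matrix.conjTranspose_apply, star_trivial, S, LinearMap.BilinForm.toMatrix_apply]
      exact covarianceBilin_comm _ _
    · rw [star_trivial, LinearMap.BilinForm.dotProduct_toMatrix_mulVec]
      exact covarianceBilin_self_nonneg _
  have hν : ν = multivariateGaussian 0 S := by
    refine IsGaussian.ext (by rw [h0, integral_id_multivariateGaussian']) ?_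
    ext x y
    rw [covarianceBilin_multivariateGaussian hS]
    exact LinearMap.BilinForm.apply_eq_dotProduct_toMatrix_mulVec b B x y
  have hstd : IsMidpointLogConcave (stdGaussian (EuclideanSpace ℝ (Fin n))) := by
    rw [← map_pi_eq_stdGaussian]
    exact (isMidpointLogConcave_pi_gaussianReal n).map
      (WithLp.linearEquiv 2 ℝ (Fin n → ℝ)).symm.toLinearMap (by fun_prop)
  rw [hν, multivariateGaussian]
  simp only [zero_add]
  exact hstd.map (Matrix.toEuclideanCLM (𝕜 := ℝ) (CFC.sqrt S)).toLinearMap (by fun_prop)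

/-- Anderson's inequality for boxes and centered Gaussian vectors. -/
lemma measure_forall_abs_add_le_of_isGaussian {n : ℕ} {ν : Measure (EuclideanSpace ℝ (Fin n))}
    [IsGaussian ν] (h0 : ν[id] = 0) (c : Fin n → ℝ) (r : ℝ) :
    ν {x | ∀ i, |x i + c i| ≤ r} ≤ ν {x | ∀ i, |x i| ≤ r} := by
  have hneg : ν.map (fun x => -x) = ν := by
    refine IsGaussian.ext ?_ ?_
    · rw [integral_map (by fun_prop) (by fun_prop)]
      simp only [id_eq] at h0 ⊢
      rw [integral_neg, h0, neg_zero]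
    · ext x y
      have := covarianceBilin_map (μ := ν) IsGaussian.memLp_two_id
        (-ContinuousLinearMap.id ℝ (EuclideanSpace ℝ (Fin n))) x y
      rw [show (fun x : EuclideanSpace ℝ (Fin n) => -x) =
        ⇑(-ContinuousLinearMap.id ℝ (EuclideanSpace ℝ (Fin n))) from rfl, this]
      have hid : ContinuousLinearMap.adjoint
          (ContinuousLinearMap.id ℝ (EuclideanSpace ℝ (Fin n))) = ContinuousLinearMap.id ℝ _ :=
        star_one (EuclideanSpace ℝ (Fin n) →L[ℝ] EuclideanSpace ℝ (Fin n))
      simp [hid]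
  have hm : ∀ d : Fin n → ℝ, MeasurableSet {x : EuclideanSpace ℝ (Fin n) | ∀ i, |x i + d i| ≤ r} :=
    fun d => by
      rw [show {x : EuclideanSpace ℝ (Fin n) | ∀ i, |x i + d i| ≤ r} =
        ⋂ i, {x | |x i + d i| ≤ r} by ext; simp]
      exact MeasurableSet.iInter fun i => measurableSet_le (by fun_prop) measurable_const
  have hm0 := hm 0
  simp only [Pi.zero_apply, add_zero] at hm0
  have hsymm : ν {x | ∀ i, |x i + (-c) i| ≤ r} = ν {x | ∀ i, |x i + c i| ≤ r} := by
    conv_rhs => rw [← hneg, Measure.map_apply (by fun_prop) (hm c)]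
    congr 1
    ext x
    refine forall_congr' fun i => ?_
    rw [← abs_neg]
    simp [add_comm]
  have key := isMidpointLogConcave_of_isGaussian h0
    ({x | ∀ i, |x i + c i| ≤ r}.indicator 1) ({x | ∀ i, |x i + (-c) i| ≤ r}.indicator 1)
    ({x | ∀ i, |x i| ≤ r}.indicator 1) (measurable_one.indicator (hm c))
    (measurable_one.indicator (hm (-c))) (measurable_one.indicator hm0)
    (fun x => indicator_le_self _ _ x) (fun x => indicator_le_self _ _ x)
    (fun x => indicator_le_self _ _ x) ?_
  · rw [lintegral_indicator_one (hm c), lintegral_indicator_one (hm (-c)),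
      lintegral_indicator_one hm0, hsymm, ← sq] at key
    exact (ENNReal.pow_le_pow_left_iff two_ne_zero).1 key
  · intro x y
    by_cases hx : x ∈ {x : EuclideanSpace ℝ (Fin n) | ∀ i, |x i + c i| ≤ r}
    · by_cases hy : y ∈ {x : EuclideanSpace ℝ (Fin n) | ∀ i, |x i + (-c) i| ≤ r}
      · have : (1 / 2 : ℝ) • (x + y) ∈ {x : EuclideanSpace ℝ (Fin n) | ∀ i, |x i| ≤ r} := by
          intro i
          have h1 := abs_le.1 (hx i)
          have h2 := abs_le.1 (hy i)
          simp only [Pi.neg_apply] at h2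
          simp only [PiLp.smul_apply, PiLp.add_apply, smul_eq_mul]
          rw [abs_le]
          constructor <;> linarith
        rw [indicator_of_mem hx, indicator_of_mem hy, indicator_of_mem this]
        simp
      · rw [indicator_of_notMem hy, mul_zero]
        exact zero_le
    · rw [indicator_of_notMem hx, zero_mul]
      exact zero_le

/-- All finite linear combinations of the family are centered Gaussian variables. -/
def IsCenteredGaussianFamily {ι Ω : Type*} [MeasurableSpace Ω] (Z : ι → Ω → ℝ)
    (μ : Measure Ω) : Prop :=
  ∀ (n : ℕ) (t : Fin n → ι) (a : Fin n → ℝ), ∃ v : ℝ≥0,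
    μ.map (fun ω => ∑ i, a i * Z (t i) ω) = gaussianReal 0 v

namespace IsCenteredGaussianFamily

variable {ι Ω : Type*} [MeasurableSpace Ω] {Z : ι → Ω → ℝ} {μ : Measure Ω}

lemma aemeasurable (hZ : IsCenteredGaussianFamily Z μ) (i : ι) : AEMeasurable (Z i) μ := by
  obtain ⟨v, hv⟩ := hZ 1 (fun _ => i) (fun _ => 1)
  simp only [Finset.univ_unique, Finset.sum_const, Finset.card_singleton, one_smul, one_mul] at hv
  refine AEMeasurable.of_map_ne_zero ?_
  rw [hv]
  exact IsProbabilityMeasure.ne_zero _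

lemma measure_forall_abs_add_le (hZ : IsCenteredGaussianFamily Z μ) {n : ℕ} (t : Fin n → ι)
    (c r : ℝ) : μ {ω | ∀ i, |Z (t i) ω + c| ≤ r} ≤ μ {ω | ∀ i, |Z (t i) ω| ≤ r} := by
  set V : Ω → EuclideanSpace ℝ (Fin n) := fun ω => WithLp.toLp 2 fun i => Z (t i) ω with hV
  have hVm : AEMeasurable V μ :=
    (WithLp.measurable_toLp 2 _).comp_aemeasurable
      (aemeasurable_pi_lambda _ fun i => hZ.aemeasurable (t i))
  have hlin : ∀ L : EuclideanSpace ℝ (Fin n) →L[ℝ] ℝ, ∃ v : ℝ≥0,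
      (μ.map V).map L = gaussianReal 0 v := by
    intro L
    obtain ⟨v, hv⟩ := hZ n t fun i => L (EuclideanSpace.single i 1)
    refine ⟨v, ?_⟩
    rw [AEMeasurable.map_map_of_aemeasurable (by fun_prop) hVm, ← hv]
    congr 1
    ext ω
    have : V ω = ∑ i, Z (t i) ω • EuclideanSpace.single i (1 : ℝ) := by
      ext j; simp [hV, Pi.single_apply]
    simp [this, mul_comm]
  have : IsGaussian (μ.map V) :=
    isGaussian_of_map_eq_gaussianReal fun L => ⟨0, hlin L⟩
  have h0 : (μ.map V)[id] = 0 := by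
    ext i
    obtain ⟨v, hv⟩ := hlin (EuclideanSpace.proj i)
    have := (EuclideanSpace.proj i : EuclideanSpace ℝ (Fin n) →L[ℝ] ℝ).integral_comp_id_comm
      (IsGaussian.integrable_id (μ := μ.map V))
    have h2 : ∫ x, x ∂((μ.map V).map (EuclideanSpace.proj i : EuclideanSpace ℝ (Fin n) →L[ℝ] ℝ))
        = 0 := by rw [hv]; simp
    rw [integral_map (by fun_prop) (by fun_prop)] at h2
    rw [h2] at this
    simpa using this.symm
  have hm : ∀ d, MeasurableSet {x : EuclideanSpace ℝ (Fin n) | ∀ i, |x i + d| ≤ r} := fun d => by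
    rw [show {x : EuclideanSpace ℝ (Fin n) | ∀ i, |x i + d| ≤ r} =
      ⋂ i, {x | |x i + d| ≤ r} by ext; simp]
    exact MeasurableSet.iInter fun i => measurableSet_le (by fun_prop) measurable_const
  have hm0 := hm 0
  simp only [add_zero] at hm0
  have key := measure_forall_abs_add_le_of_isGaussian h0 (fun _ => c) r
  rwa [Measure.map_apply_of_aemeasurable hVm (hm c),
    Measure.map_apply_of_aemeasurable hVm hm0] at key

end IsCenteredGaussianFamily

/-- Linear combinations determine the joint law of finitely many random variables. -/
lemma map_pi_eq_of_forall_map_sum_eq {Ω Ω' : Type*} [MeasurableSpace Ω] [MeasurableSpace Ω']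
    {μ : Measure Ω} {μ' : Measure Ω'} [IsFiniteMeasure μ] [IsFiniteMeasure μ'] {n : ℕ}
    {Z : Fin n → Ω → ℝ} {Z' : Fin n → Ω' → ℝ} (hZ : ∀ i, AEMeasurable (Z i) μ)
    (hZ' : ∀ i, AEMeasurable (Z' i) μ')
    (h : ∀ a : Fin n → ℝ,
      μ.map (fun ω => ∑ i, a i * Z i ω) = μ'.map (fun ω => ∑ i, a i * Z' i ω)) :
    μ.map (fun ω i => Z i ω) = μ'.map (fun ω i => Z' i ω) := by
  refine Measure.ext_of_charFunDual ?_
  ext L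
  rw [charFunDual_eq_charFun_map_one, charFunDual_eq_charFun_map_one,
    AEMeasurable.map_map_of_aemeasurable (by fun_prop) (aemeasurable_pi_lambda _ hZ),
    AEMeasurable.map_map_of_aemeasurable (by fun_prop) (aemeasurable_pi_lambda _ hZ')]
  have hL : ∀ x : Fin n → ℝ, L x = ∑ i, L (Pi.single i 1) * x i := by
    intro x
    conv_lhs => rw [pi_eq_sum_univ' x]
    simp [mul_comm]
  have := h fun i => L (Pi.single i 1)
  have e : (⇑L ∘ fun ω i => Z i ω) = fun ω => ∑ i, L (Pi.single i 1) * Z i ω :=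
    funext fun ω => hL _
  have e' : (⇑L ∘ fun ω i => Z' i ω) = fun ω => ∑ i, L (Pi.single i 1) * Z' i ω :=
    funext fun ω => hL _
  rw [e, e', this]

lemma measure_forall_abs_le_eq {Ω Ω' : Type*} [MeasurableSpace Ω] [MeasurableSpace Ω']
    {μ : Measure Ω} {μ' : Measure Ω'} [IsFiniteMeasure μ] [IsFiniteMeasure μ'] {n : ℕ}
    {Z : Fin n → Ω → ℝ} {Z' : Fin n → Ω' → ℝ} (hZ : ∀ i, AEMeasurable (Z i) μ)
    (hZ' : ∀ i, AEMeasurable (Z' i) μ')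
    (h : ∀ a : Fin n → ℝ,
      μ.map (fun ω => ∑ i, a i * Z i ω) = μ'.map (fun ω => ∑ i, a i * Z' i ω)) (r : ℝ) :
    μ {ω | ∀ i, |Z i ω| ≤ r} = μ' {ω | ∀ i, |Z' i ω| ≤ r} := by
  have hm : MeasurableSet {x : Fin n → ℝ | ∀ i, |x i| ≤ r} := by
    rw [show {x : Fin n → ℝ | ∀ i, |x i| ≤ r} = ⋂ i, {x | |x i| ≤ r} by ext; simp]
    exact MeasurableSet.iInter fun i => measurableSet_le (by fun_prop) measurable_const
  have := congrArg (fun ν => ν {x : Fin n → ℝ | ∀ i, |x i| ≤ r})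
    (map_pi_eq_of_forall_map_sum_eq hZ hZ' h)
  simp only [Measure.map_apply_of_aemeasurable (aemeasurable_pi_lambda _ hZ) hm,
    Measure.map_apply_of_aemeasurable (aemeasurable_pi_lambda _ hZ') hm] at this
  exact this

/-- Comparison of the laws of countably many variables through finitely many of them. -/
lemma measure_forall_le_of_forall_fin {Ω Ω' : Type*} [MeasurableSpace Ω] [MeasurableSpace Ω']
    {μ : Measure Ω} {μ' : Measure Ω'} [IsFiniteMeasure μ'] {Z : ℕ → Ω → ℝ}
    {Z' : ℕ → Ω' → ℝ} (hZ' : ∀ i, AEMeasurable (Z' i) μ') {r : ℝ}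
    (h : ∀ n, μ {ω | ∀ i : Fin n, |Z i ω| ≤ r} ≤ μ' {ω | ∀ i : Fin n, |Z' i ω| ≤ r}) :
    μ {ω | ∀ i, |Z i ω| ≤ r} ≤ μ' {ω | ∀ i, |Z' i ω| ≤ r} := by
  have hinter : {ω | ∀ i, |Z' i ω| ≤ r} = ⋂ n : ℕ, {ω | ∀ i : Fin n, |Z' i ω| ≤ r} := by
    ext ω
    simp only [mem_ofPred_eq, mem_iInter]
    exact ⟨fun h n i => h i, fun h i => h (i + 1) ⟨i, i.lt_succ_self⟩⟩
  have hlim : Tendsto (fun n : ℕ => μ' {ω | ∀ i : Fin n, |Z' i ω| ≤ r}) atTop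
      (nhds (μ' {ω | ∀ i, |Z' i ω| ≤ r})) := by
    rw [hinter]
    refine tendsto_measure_iInter_atTop (fun n => ?_) (fun m n hmn ω (hω : ∀ i : Fin n, _) i => ?_)
      ⟨0, measure_ne_top _ _⟩
    · rw [show {ω | ∀ i : Fin n, |Z' i ω| ≤ r} = ⋂ i : Fin n, {ω | |Z' i ω| ≤ r} by ext; simp]
      exact NullMeasurableSet.iInter fun i =>
        nullMeasurableSet_le (hZ' i).abs aemeasurable_const
    · exact hω (Fin.castLE hmn i)
  exact ge_of_tendsto' hlim fun n => (measure_mono fun ω (hω : ∀ i : ℕ, _) (i : Fin n) => hω i).trans (h n)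

lemma DenseRange.forall_abs_le_iff {T κ : Type*} [TopologicalSpace T] {d : κ → T}
    (hd : DenseRange d) {f : T → ℝ} (hf : Continuous f) {r : ℝ} :
    (∀ t, |f t| ≤ r) ↔ ∀ k, |f (d k)| ≤ r :=
  ⟨fun h _ => h _, fun h t => hd.induction_on t (isClosed_le hf.abs continuous_const) h⟩

section ContinuousPaths

variable {T Ω Ω' : Type*} [TopologicalSpace T] [TopologicalSpace.SeparableSpace T] [Nonempty T]
  [MeasurableSpace Ω] [MeasurableSpace Ω'] {μ : Measure Ω} {μ' : Measure Ω'}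
  {Z : T → Ω → ℝ} {Z' : T → Ω' → ℝ}

lemma measure_forall_abs_le_eq_of_continuous [IsFiniteMeasure μ] [IsFiniteMeasure μ']
    (hZc : ∀ ω, Continuous fun t => Z t ω) (hZc' : ∀ ω, Continuous fun t => Z' t ω)
    (hZ : ∀ t, AEMeasurable (Z t) μ) (hZ' : ∀ t, AEMeasurable (Z' t) μ')
    (h : ∀ (n : ℕ) (t : Fin n → T) (a : Fin n → ℝ),
      μ.map (fun ω => ∑ i, a i * Z (t i) ω) = μ'.map (fun ω => ∑ i, a i * Z' (t i) ω)) (r : ℝ) :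
    μ {ω | ∀ t, |Z t ω| ≤ r} = μ' {ω | ∀ t, |Z' t ω| ≤ r} := by
  obtain ⟨d, hd⟩ := TopologicalSpace.exists_dense_seq T
  simp only [hd.forall_abs_le_iff (hZc _), hd.forall_abs_le_iff (hZc' _)]
  have key : ∀ n : ℕ, μ {ω | ∀ i : Fin n, |Z (d i) ω| ≤ r} =
      μ' {ω | ∀ i : Fin n, |Z' (d i) ω| ≤ r} := fun n =>
    measure_forall_abs_le_eq (Z := fun (i : Fin n) => Z (d i)) (Z' := fun (i : Fin n) => Z' (d i))
      (fun i => hZ _) (fun i => hZ' _) (h n _) r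
  exact le_antisymm
    (measure_forall_le_of_forall_fin (Z := fun i => Z (d i)) (Z' := fun i => Z' (d i))
      (fun i => hZ' _) fun n => (key n).le)
    (measure_forall_le_of_forall_fin (Z := fun i => Z' (d i)) (Z' := fun i => Z (d i))
      (fun i => hZ _) fun n => (key n).ge)

namespace IsCenteredGaussianFamily

lemma measure_forall_abs_add_le_of_continuous [IsFiniteMeasure μ]
    (hZ : IsCenteredGaussianFamily Z μ) (hZc : ∀ ω, Continuous fun t => Z t ω) (c r : ℝ) :
    μ {ω | ∀ t, |Z t ω + c| ≤ r} ≤ μ {ω | ∀ t, |Z t ω| ≤ r} := by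
  obtain ⟨d, hd⟩ := TopologicalSpace.exists_dense_seq T
  simp only [hd.forall_abs_le_iff (hZc _),
    fun ω => hd.forall_abs_le_iff (f := fun t => Z t ω + c) (r := r)
      ((hZc ω).add continuous_const)]
  exact measure_forall_le_of_forall_fin (Z := fun i ω => Z (d i) ω + c) (Z' := fun i => Z (d i))
    (fun i => hZ.aemeasurable _) fun n => hZ.measure_forall_abs_add_le (fun i : Fin n => d i) c r

/-- If the range of a path has length at most `2 * r`, a small shift puts it into a centered
interval; Anderson's inequality removes the shift. -/
lemma measure_forall_abs_sub_le [CompactSpace T] [IsFiniteMeasure μ]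
    (hZ : IsCenteredGaussianFamily Z μ) (hZc : ∀ ω, Continuous fun t => Z t ω) {t₀ : T}
    (h0 : ∀ᵐ ω ∂μ, Z t₀ ω = 0) {m : ℕ} (hm : 0 < m) {r : ℝ} (hr : 0 < r) :
    μ {ω | ∀ s t, |Z s ω - Z t ω| ≤ 2 * r} ≤
      (2 * m + 1 : ℕ) * μ {ω | ∀ t, |Z t ω| ≤ (1 + 1 / m) * r} := by
  have hm' : (0 : ℝ) < m := by exact_mod_cast hm
  have hsub : {ω | ∀ s t, |Z s ω - Z t ω| ≤ 2 * r} ≤ᵐ[μ]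
      ⋃ k ∈ Finset.Icc (-m : ℤ) m, {ω | ∀ t, |Z t ω + (-(k * (r / m)))| ≤ (1 + 1 / m) * r} := by
    filter_upwards [h0] with ω hω (hosc : ∀ s t, |Z s ω - Z t ω| ≤ 2 * r)
    obtain ⟨p, hp⟩ : ∃ p, ∀ t, Z p ω ≤ Z t ω := by
      obtain ⟨p, -, hp⟩ := isCompact_univ.exists_isMinOn univ_nonempty (hZc ω).continuousOn
      exact ⟨p, fun t => hp (mem_univ t)⟩
    obtain ⟨q, hq⟩ : ∃ q, ∀ t, Z t ω ≤ Z q ω := by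
      obtain ⟨q, -, hq⟩ := isCompact_univ.exists_isMaxOn univ_nonempty (hZc ω).continuousOn
      exact ⟨q, fun t => hq (mem_univ t)⟩
    have hpq := (abs_le.1 (hosc q p)).2
    have hp0 := hω ▸ hp t₀
    have hq0 := hω ▸ hq t₀
    set v := (Z p ω + Z q ω) / 2 with hv
    have hv1 : -r ≤ v := by linarith
    have hv2 : v ≤ r := by linarith
    have hk1 := Int.floor_le (v * m / r)
    have hk2 := Int.lt_floor_add_one (v * m / r)
    have e : v = v * m / r * (r / m) := by field_simp
    have hrm : 0 < r / m := by positivity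
    change ω ∈ ⋃ k ∈ Finset.Icc (-m : ℤ) m, {ω | ∀ t, |Z t ω + (-(k * (r / m)))| ≤ (1 + 1 / m) * r}
    simp only [mem_iUnion, exists_prop]
    refine ⟨⌊v * m / r⌋, Finset.mem_Icc.2 ⟨Int.le_floor.2 ?_, Int.floor_le_iff.2 ?_⟩, fun t => ?_⟩
    · rw [le_div_iff₀ hr]; push_cast; nlinarith
    · rw [div_lt_iff₀ hr]; push_cast; nlinarith
    · have h1 : (⌊v * m / r⌋ : ℝ) * (r / m) ≤ v := by
        rw [e]; gcongr; rwa [← e]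
      have h2 : v ≤ (⌊v * m / r⌋ : ℝ) * (r / m) + r / m := by
        nlinarith
      have h3 := hp t
      have h4 := hq t
      have h5 : (1 + 1 / (m : ℝ)) * r = r + r / m := by ring
      rw [h5, abs_le]
      constructor <;> linarith
  refine (measure_mono_ae hsub).trans ((measure_biUnion_finset_le _ _).trans ?_)
  refine (Finset.sum_le_sum fun k _ =>
    hZ.measure_forall_abs_add_le_of_continuous hZc _ _).trans ?_
  rw [Finset.sum_const, nsmul_eq_mul, Int.card_Icc]
  gcongr
  omega

end IsCenteredGaussianFamily

end ContinuousPaths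

section FBM

variable {H : ℝ} {X Y : ℝ → Ω → ℝ}

lemma IsTrueFBM.isCenteredGaussianFamily (hX : IsTrueFBM H X) : IsCenteredGaussianFamily X ℙ :=
  fun n t a => ⟨_, hX n t a⟩

lemma HasFBMFdds.isCenteredGaussianFamily (hY : HasFBMFdds H (Icc 0 1) Y) :
    IsCenteredGaussianFamily (fun t : Icc (0 : ℝ) 1 => Y t) ℙ :=
  fun n t a => ⟨_, hY n (fun i => t i) (fun i => (t i).2) a⟩

lemma ae_eq_zero_of_map_eq_gaussianReal_zero {f : Ω → ℝ}
    (h : Measure.map f ℙ = gaussianReal 0 0) : ∀ᵐ ω, f ω = 0 := by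
  have hf : AEMeasurable f ℙ := AEMeasurable.of_map_ne_zero (by
    rw [h]; exact IsProbabilityMeasure.ne_zero _)
  rw [gaussianReal_zero_var] at h
  have : ∀ᵐ x ∂(Measure.map f ℙ), x = 0 := by
    rw [h, ae_dirac_eq]; rfl
  exact ae_of_ae_map hf this

lemma IsTrueFBM.ae_zero (hX : IsTrueFBM H X) (hH : 0 < H) : ∀ᵐ ω, X 0 ω = 0 := by
  refine ae_eq_zero_of_map_eq_gaussianReal_zero ?_
  have : Measure.map (fun ω => X 0 ω) ℙ = gaussianReal 0 0 := by
    have := hX 1 (fun _ => 0) (fun _ => 1)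
    simpa [Real.zero_rpow (mul_pos two_pos hH).ne', -gaussianReal_zero_var] using this
  exact this

lemma HasFBMFdds.ae_zero (hY : HasFBMFdds H (Icc 0 1) Y) (hH : 0 < H) : ∀ᵐ ω, Y 0 ω = 0 := by
  refine ae_eq_zero_of_map_eq_gaussianReal_zero ?_
  have : Measure.map (fun ω => Y 0 ω) ℙ = gaussianReal 0 0 := by
    have := hY 1 (fun _ => 0) (by simp) (fun _ => 1)
    simpa [Real.zero_rpow (mul_pos two_pos hH).ne', -gaussianReal_zero_var] using this
  exact this

/-- Stationarity of increments and self-similarity, for linear combinations. -/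
lemma IsTrueFBM.map_sum_increment (hX : IsTrueFBM H X) (hH : 0 < H) (u : ℝ) {L : ℝ} (hL : 0 ≤ L)
    {n : ℕ} (t a : Fin n → ℝ) :
    Measure.map (fun ω => ∑ i, a i * (X (u + L * t i) ω - X u ω)) ℙ =
      Measure.map (fun ω => ∑ i, a i * (L ^ H * X (t i) ω)) ℙ := by
  have h1 := hX (n + 1) (Fin.cons u fun i => u + L * t i) (Fin.cons (-∑ i, a i) a)
  have h2 := hX n t fun i => a i * L ^ H
  have e1 : (fun ω => ∑ i, a i * (X (u + L * t i) ω - X u ω)) = fun ω => ∑ i : Fin (n + 1),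
      (Fin.cons (-∑ i, a i) a : Fin (n + 1) → ℝ) i *
        X ((Fin.cons u fun i => u + L * t i : Fin (n + 1) → ℝ) i) ω := by
    ext ω
    simp only [Fin.sum_univ_succ, Fin.cons_zero, Fin.cons_succ, mul_sub, Finset.sum_sub_distrib]
    rw [← Finset.sum_mul]
    ring
  have e2 : (fun ω => ∑ i, a i * (L ^ H * X (t i) ω)) =
      fun ω => ∑ i, a i * L ^ H * X (t i) ω := by simp only [mul_assoc]
  rw [e1, e2, h1, h2]
  congr 2
  have hL2 : L ^ (2 * H) = L ^ H * L ^ H := by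
    rw [two_mul, Real.rpow_add_of_nonneg hL hH.le hH.le]
  have hsc : ∀ x : ℝ, |L * x| ^ (2 * H) = L ^ H * L ^ H * |x| ^ (2 * H) := fun x => by
    rw [abs_mul, abs_of_nonneg hL, Real.mul_rpow hL (abs_nonneg _), hL2]
  have h0 : (0 : ℝ) ^ (2 * H) = 0 := Real.zero_rpow (by positivity)
  have expand : ∀ (f : Fin n → Fin n → ℝ) (g : Fin n → ℝ) (k : ℝ),
      (-∑ i, a i) * (-∑ i, a i) * k + ∑ j, (-∑ i, a i) * a j * g j +
        ∑ i, (a i * (-∑ i, a i) * g i + ∑ j, a i * a j * f i j) =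
      ∑ i, ∑ j, a i * a j * (f i j - g i - g j + k) := by
    intro f g k
    simp only [mul_add, mul_sub, Finset.sum_add_distrib, Finset.sum_sub_distrib]
    have s1 : ∑ i, ∑ j, a i * a j * k = (∑ i, a i) * (∑ i, a i) * k := by
      rw [Finset.sum_mul_sum, Finset.sum_mul]
      simp only [Finset.sum_mul]
    have s2 : ∑ i, ∑ j, a i * a j * g i = ∑ i, a i * (∑ i, a i) * g i := by
      simp only [Finset.sum_mul, Finset.mul_sum]
    have s3 : ∑ i, ∑ j, a i * a j * g j = ∑ j, (∑ i, a i) * a j * g j := by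
      rw [Finset.sum_comm]
      simp only [Finset.sum_mul]
    rw [s1, s2, s3]
    simp only [mul_neg, neg_mul, Finset.sum_neg_distrib]
    have s4 : ∑ i, a i * (∑ i, a i) * g i = ∑ j, (∑ i, a i) * a j * g j := by
      simp only [mul_comm]
    rw [s4]
    ring
  simp only [Fin.sum_univ_succ, Fin.cons_zero, Fin.cons_succ]
  have comm : ∀ i, |u + L * t i - u| = |u - (u + L * t i)| := fun i => abs_sub_comm _ _
  have := expand (fun i j => 1 / 2 * (|u + L * t i| ^ (2 * H) + |u + L * t j| ^ (2 * H) -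
    |u + L * t i - (u + L * t j)| ^ (2 * H))) (fun i => 1 / 2 * (|u| ^ (2 * H) +
    |u + L * t i| ^ (2 * H) - |u - (u + L * t i)| ^ (2 * H)))
    (1 / 2 * (|u| ^ (2 * H) + |u| ^ (2 * H) - |u - u| ^ (2 * H)))
  have swap : ∀ i, |u + L * t i| ^ (2 * H) + |u| ^ (2 * H) - |u + L * t i - u| ^ (2 * H) =
      |u| ^ (2 * H) + |u + L * t i| ^ (2 * H) - |u - (u + L * t i)| ^ (2 * H) :=
    fun i => by rw [comm]; ring
  simp only [swap]
  rw [this]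
  refine Finset.sum_congr rfl fun i _ => Finset.sum_congr rfl fun j _ => ?_
  rw [← comm i, ← comm j, show u + L * t i - u = L * t i by ring,
    show u + L * t j - u = L * t j by ring,
    show u + L * t i - (u + L * t j) = L * (t i - t j) by ring, hsc, hsc, hsc, sub_self, abs_zero,
    h0]
  ring

lemma IsTrueFBM.increment_isCenteredGaussianFamily (hX : IsTrueFBM H X) (hH : 0 < H) (u : ℝ)
    {L : ℝ} (hL : 0 ≤ L) :
    IsCenteredGaussianFamily (fun (t : Icc (0 : ℝ) 1) ω => X (u + L * t) ω - X u ω) ℙ := by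
  intro n t a
  have := hX n (fun i => t i) fun i => a i * L ^ H
  exact ⟨_, (hX.map_sum_increment hH u hL (fun i => (t i : ℝ)) a).trans (by
    simp only [mul_assoc] at this ⊢; exact this)⟩

section SmallBall

variable [IsProbabilityMeasure (ℙ : Measure Ω)]

lemma IsTrueFBM.measure_increment_le (hX : IsTrueFBM H X) (hXc : ∀ ω, Continuous fun t => X t ω)
    (hH : 0 < H) (u : ℝ) {L : ℝ} (hL : 0 < L) (r : ℝ) :
    ℙ {ω | ∀ t : Icc (0 : ℝ) 1, |X (u + L * t) ω - X u ω| ≤ r} =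
      ℙ {ω | ∀ t : Icc (0 : ℝ) 1, |X t ω| ≤ r / L ^ H} := by
  have hLH : 0 < L ^ H := Real.rpow_pos_of_pos hL H
  have hZ := hX.isCenteredGaussianFamily
  have := measure_forall_abs_le_eq_of_continuous (μ := ℙ) (μ' := ℙ)
    (Z := fun (t : Icc (0 : ℝ) 1) ω => X (u + L * t) ω - X u ω)
    (Z' := fun (t : Icc (0 : ℝ) 1) ω => L ^ H * X t ω)
    (fun ω => ((hXc ω).comp (by fun_prop)).sub continuous_const)
    (fun ω => continuous_const.mul ((hXc ω).comp continuous_subtype_val))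
    (fun t => (hZ.aemeasurable _).sub (hZ.aemeasurable _))
    (fun t => (hZ.aemeasurable _).const_mul _)
    (fun n t a => hX.map_sum_increment hH u hL.le (fun i => (t i : ℝ)) a) r
  rw [this]
  simp only [abs_mul, abs_of_pos hLH, le_div_iff₀' hLH]

lemma IsTrueFBM.measure_interval_le (hX : IsTrueFBM H X)
    (hXc : ∀ ω, Continuous fun t => X t ω) (hH : 0 < H) {a b : ℝ} (hab : 0 < a + b)
    {m : ℕ} (hm : 0 < m) {r : ℝ} (hr : 0 < r) :
    ℙ {ω | ∀ s ∈ Icc (-a) b, |X s ω| ≤ r} ≤ (2 * m + 1 : ℕ) *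
      ℙ {ω | ∀ t : Icc (0 : ℝ) 1, |X t ω| ≤ (1 + 1 / m) * r / (a + b) ^ H} := by
  rw [← hX.measure_increment_le hXc hH (-a) hab]
  refine (measure_mono fun ω (hω : ∀ s ∈ Icc (-a) b, |X s ω| ≤ r) => ?_).trans
    ((hX.increment_isCenteredGaussianFamily hH (-a) hab.le).measure_forall_abs_sub_le
      (fun ω => ((hXc ω).comp (by fun_prop)).sub continuous_const) (t₀ := 0)
      (ae_of_all _ fun ω => by simp) hm hr)
  have hmem : ∀ t : Icc (0 : ℝ) 1, |X (-a + (a + b) * t) ω| ≤ r := fun t =>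
    hω _ ⟨by nlinarith [t.2.1], by nlinarith [t.2.2]⟩
  intro s t
  have h1 := abs_le.1 (hmem s)
  have h2 := abs_le.1 (hmem t)
  rw [abs_le]
  constructor <;> linarith

lemma IsTrueFBM.le_measure_interval (hX : IsTrueFBM H X)
    (hXc : ∀ ω, Continuous fun t => X t ω) (hH : 0 < H) {a b : ℝ} (ha : 0 ≤ a) (hb : 0 ≤ b)
    (hab : 0 < a + b) {m : ℕ} (hm : 0 < m) {r : ℝ} (hr : 0 < r) :
    ℙ {ω | ∀ t : Icc (0 : ℝ) 1, |X t ω| ≤ r / (a + b) ^ H} ≤ (2 * m + 1 : ℕ) *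
      ℙ {ω | ∀ s ∈ Icc (-a) b, |X s ω| ≤ (1 + 1 / m) * r} := by
  rw [← hX.measure_increment_le hXc hH (-a) hab]
  have hfam : IsCenteredGaussianFamily (fun (t : Icc (0 : ℝ) 1) ω => X (-a + (a + b) * t) ω) ℙ :=
    fun n t c => hX.isCenteredGaussianFamily n (fun i => -a + (a + b) * t i) c
  have h0 : a / (a + b) ∈ Icc (0 : ℝ) 1 :=
    ⟨by positivity, (div_le_one hab).2 (by linarith)⟩
  have key := hfam.measure_forall_abs_sub_le (fun ω => (hXc ω).comp (by fun_prop))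
    (t₀ := ⟨_, h0⟩) (by
      filter_upwards [hX.ae_zero hH] with ω hω
      rw [show -a + (a + b) * (a / (a + b)) = 0 by field_simp; ring, hω]) hm hr
  refine (measure_mono fun ω hω s t => ?_).trans (key.trans ?_)
  · have h1 := abs_le.1 (hω s)
    have h2 := abs_le.1 (hω t)
    rw [abs_le]
    constructor <;> linarith
  · refine mul_le_mul' le_rfl (measure_mono fun ω hω s hs => ?_)
    have hmem : (s + a) / (a + b) ∈ Icc (0 : ℝ) 1 :=
      ⟨div_nonneg (by linarith [hs.1]) hab.le, (div_le_one hab).2 (by linarith [hs.2])⟩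
    have := hω ⟨_, hmem⟩
    rwa [show -a + (a + b) * ((s + a) / (a + b)) = s by field_simp; ring] at this

lemma HasFBMFdds.measure_oscillation_le (hY : HasFBMFdds H (Icc 0 1) Y)
    (hYc : ∀ ω, ContinuousOn (fun t => Y t ω) (Icc 0 1)) (hH : 0 < H) {m : ℕ} (hm : 0 < m)
    {r : ℝ} (hr : 0 < r) :
    ℙ {ω | ∀ s t : Icc (0 : ℝ) 1, |Y s ω - Y t ω| ≤ 2 * r} ≤ (2 * m + 1 : ℕ) *
      ℙ {ω | ∀ t : Icc (0 : ℝ) 1, |Y t ω| ≤ (1 + 1 / m) * r} :=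
  hY.isCenteredGaussianFamily.measure_forall_abs_sub_le
    (fun ω => continuousOn_iff_continuous_domRestrict.1 (hYc ω)) (t₀ := 0) (hY.ae_zero hH) hm hr

end SmallBall

end FBM

section ExponentialBounds

variable {q : ℝ → ℝ} {c p θ : ℝ}

lemma exists_mul_exp_le_of_tendsto (hq : Monotone q) (hq0 : ∀ x, 0 ≤ q x) (hq1 : ∀ x, q x ≤ 1)
    (hc : 0 < c)
    (h : Tendsto (fun ε => -Real.log (q ε) / (c * ε ^ (-p))) (nhdsWithin 0 (Ioi 0)) (nhds 1))
    (hθ : 1 < θ) : ∃ C > 0, ∀ ρ > 0, C * Real.exp (-(θ * c * ρ ^ (-p))) ≤ q ρ := by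
  have ev := (h.eventually_lt_const hθ).and (h.eventually_const_lt one_pos)
  obtain ⟨ε₀, hε₀, hev⟩ := mem_nhdsGT_iff_exists_Ioo_subset.1 ev
  have hpos : ∀ ε ∈ Ioo 0 ε₀, 0 < q ε := fun ε hε => by
    refine (hq0 ε).lt_of_ne fun h0 => ?_
    have := (hev hε).2
    simp [← h0] at this
  have hmid : ε₀ / 2 ∈ Ioo 0 ε₀ := ⟨half_pos hε₀, half_lt_self hε₀⟩
  refine ⟨q (ε₀ / 2), hpos _ hmid, fun ρ hρ => ?_⟩
  have hD : 0 < c * ρ ^ (-p) := mul_pos hc (Real.rpow_pos_of_pos hρ _)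
  rcases lt_or_ge ρ ε₀ with hlt | hge
  · have h1 := (hev ⟨hρ, hlt⟩).1
    rw [div_lt_iff₀ hD] at h1
    refine (mul_le_of_le_one_left (Real.exp_pos _).le (hq1 _)).trans ?_
    rw [← Real.le_log_iff_exp_le (hpos _ ⟨hρ, hlt⟩)]
    linarith
  · refine (mul_le_of_le_one_right (hq0 _) (Real.exp_le_one_iff.2 ?_)).trans
      (hq (by linarith [hmid.2]))
    rw [mul_assoc]
    exact neg_nonpos.2 (mul_nonneg (by linarith) hD.le)

lemma exists_le_mul_exp_of_tendsto (hq1 : ∀ x, q x ≤ 1) (hc : 0 < c) (hp : 0 < p)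
    (h : Tendsto (fun ε => -Real.log (q ε) / (c * ε ^ (-p))) (nhdsWithin 0 (Ioi 0)) (nhds 1))
    (hθ0 : 0 < θ) (hθ : θ < 1) :
    ∃ C, 1 ≤ C ∧ ∀ ρ > 0, q ρ ≤ C * Real.exp (-(θ * c * ρ ^ (-p))) := by
  obtain ⟨ε₀, hε₀, hev⟩ := mem_nhdsGT_iff_exists_Ioo_subset.1 (h.eventually_const_lt hθ)
  have hC : 1 ≤ Real.exp (θ * c * ε₀ ^ (-p)) :=
    Real.one_le_exp (mul_nonneg (mul_pos hθ0 hc).le (Real.rpow_pos_of_pos hε₀ _).le)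
  refine ⟨_, hC, fun ρ hρ => ?_⟩
  have hD : 0 < c * ρ ^ (-p) := mul_pos hc (Real.rpow_pos_of_pos hρ _)
  rcases lt_or_ge ρ ε₀ with hlt | hge
  · have h1 := hev ⟨hρ, hlt⟩
    simp only [mem_ofPred_eq] at h1
    rw [lt_div_iff₀ hD] at h1
    refine (Real.le_exp_log _).trans ((Real.exp_le_exp.2 ?_).trans
      (le_mul_of_one_le_left (Real.exp_pos _).le hC))
    linarith
  · rw [← Real.exp_add]
    refine (hq1 _).trans (Real.one_le_exp ?_)
    have : ρ ^ (-p) ≤ ε₀ ^ (-p) := Real.rpow_le_rpow_of_nonpos hε₀ hge (by linarith)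
    nlinarith [mul_pos hθ0 hc]

lemma exists_one_add_rpow_mul_lt {x y : ℝ} (p : ℝ) (h : x < y) :
    ∃ m : ℕ, 0 < m ∧ (1 + 1 / (m : ℝ)) ^ p * x < y := by
  have hlim : Tendsto (fun m : ℕ => (1 + 1 / (m : ℝ)) ^ p * x) atTop (nhds (1 ^ p * x)) := by
    refine Tendsto.mul_const _ (Tendsto.rpow_const ?_ (Or.inl one_ne_zero))
    simpa using tendsto_one_div_atTop_nhds_zero_nat.const_add (1 : ℝ)
  rw [Real.one_rpow, one_mul] at hlim
  obtain ⟨m, hm, hm0⟩ := ((hlim.eventually_lt_const h).and (eventually_gt_atTop 0)).exists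
  exact ⟨m, hm0, hm⟩

lemma exists_mul_exp_le_div (hq : Monotone q) (hq0 : ∀ x, 0 ≤ q x) (hq1 : ∀ x, q x ≤ 1)
    (hc : 0 < c)
    (h : Tendsto (fun ε => -Real.log (q ε) / (c * ε ^ (-p))) (nhdsWithin 0 (Ioi 0)) (nhds 1))
    (hθ : 1 < θ) : ∃ m : ℕ, 0 < m ∧ ∃ C > 0, ∀ ρ > 0,
      C * Real.exp (-(θ * c * ρ ^ (-p))) ≤ q (ρ / (1 + 1 / m)) := by
  obtain ⟨θ', h1, h2⟩ := exists_between hθ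
  obtain ⟨m, hm, hmθ⟩ := exists_one_add_rpow_mul_lt p h2
  obtain ⟨C, hC, hb⟩ := exists_mul_exp_le_of_tendsto hq hq0 hq1 hc h h1
  have hm' : (0 : ℝ) < 1 + 1 / m := by positivity
  refine ⟨m, hm, C, hC, fun ρ hρ => le_trans ?_ (hb _ (div_pos hρ hm'))⟩
  have hρp := Real.rpow_pos_of_pos hρ (-p)
  gcongr C * Real.exp (-?_)
  rw [Real.div_rpow hρ.le hm'.le, Real.rpow_neg hm'.le, div_inv_eq_mul]
  calc θ' * c * (ρ ^ (-p) * (1 + 1 / (m : ℝ)) ^ p)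
      = ((1 + 1 / (m : ℝ)) ^ p * θ') * (c * ρ ^ (-p)) := by ring
    _ ≤ θ * (c * ρ ^ (-p)) := by gcongr
    _ = θ * c * ρ ^ (-p) := by ring

lemma exists_mul_le_mul_exp (hq1 : ∀ x, q x ≤ 1) (hc : 0 < c) (hp : 0 < p)
    (h : Tendsto (fun ε => -Real.log (q ε) / (c * ε ^ (-p))) (nhdsWithin 0 (Ioi 0)) (nhds 1))
    (hθ0 : 0 < θ) (hθ : θ < 1) : ∃ m : ℕ, 0 < m ∧ ∃ C, 1 ≤ C ∧ ∀ ρ > 0,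
      q ((1 + 1 / m) * ρ) ≤ C * Real.exp (-(θ * c * ρ ^ (-p))) := by
  obtain ⟨θ', h1, h2⟩ := exists_between hθ
  obtain ⟨m, hm, hmθ⟩ := exists_one_add_rpow_mul_lt p h1
  obtain ⟨C, hC, hb⟩ := exists_le_mul_exp_of_tendsto hq1 hc hp h (hθ0.trans h1) h2
  have hm' : (0 : ℝ) < 1 + 1 / m := by positivity
  refine ⟨m, hm, C, hC, fun ρ hρ => (hb _ (mul_pos hm' hρ)).trans ?_⟩
  have hρp := Real.rpow_pos_of_pos hρ (-p)
  have hmp := Real.rpow_pos_of_pos hm' p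
  gcongr C * Real.exp (-?_)
  rw [Real.mul_rpow hm'.le hρ.le, Real.rpow_neg hm'.le]
  calc θ * c * ρ ^ (-p) = ((1 + 1 / (m : ℝ)) ^ p)⁻¹ * (((1 + 1 / (m : ℝ)) ^ p) * θ) *
        (c * ρ ^ (-p)) := by field_simp
    _ ≤ ((1 + 1 / (m : ℝ)) ^ p)⁻¹ * θ' * (c * ρ ^ (-p)) := by gcongr
    _ = θ' * c * (((1 + 1 / (m : ℝ)) ^ p)⁻¹ * ρ ^ (-p)) := by ring

end ExponentialBounds

lemma div_rpow_rpow_neg_inv {H L ε : ℝ} (hH : 0 < H) (hL : 0 < L) (hε : 0 < ε) :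
    (ε / L ^ H) ^ (-(1 / H)) = L * ε ^ (-(1 / H)) := by
  rw [Real.div_rpow hε.le (Real.rpow_pos_of_pos hL H).le, ← Real.rpow_mul hL.le,
    show H * -(1 / H) = -1 by field_simp, Real.rpow_neg_one, div_inv_eq_mul, mul_comm]

lemma iSup_mem_Icc_le_iff {f : ℝ → ℝ} (hf : ContinuousOn f (Icc 0 1)) (hf0 : ∀ t, 0 ≤ f t)
    {r : ℝ} (hr : 0 ≤ r) : ⨆ t ∈ Icc (0 : ℝ) 1, f t ≤ r ↔ ∀ t : Icc (0 : ℝ) 1, f t ≤ r := by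
  obtain ⟨M, hM⟩ := (isCompact_Icc.image_of_continuousOn hf).bddAbove
  have hM0 : 0 ≤ M := (hf0 0).trans (hM ⟨0, by simp, rfl⟩)
  have hbdd : BddAbove (range fun t => ⨆ _ : t ∈ Icc (0 : ℝ) 1, f t) := by
    refine ⟨M, ?_⟩
    rintro _ ⟨t, rfl⟩
    exact Real.iSup_le (fun ht => hM ⟨t, ht, rfl⟩) hM0
  refine ⟨fun h t => ?_, fun h => Real.iSup_le (fun t => Real.iSup_le (fun ht => h ⟨t, ht⟩) hr) hr⟩
  refine le_trans ?_ ((le_ciSup hbdd t.1).trans h)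
  rw [ciSup_pos t.2]

section Estimates

variable {H c θ : ℝ} {X Y Z : ℝ → Ω → ℝ}

lemma strongEquiv.tendsto_measureReal {p : ℝ} (hZc : ∀ ω, ContinuousOn (fun t => Z t ω) (Icc 0 1))
    (h : strongEquiv
      (fun ε => -Real.log ((ℙ {ω | ⨆ t ∈ Icc (0 : ℝ) 1, |Z t ω| ≤ ε}).toReal))
      (fun ε => c * ε ^ (-p))) :
    Tendsto (fun ε => -Real.log ((ℙ : Measure Ω).real {ω | ∀ t : Icc (0 : ℝ) 1, |Z t ω| ≤ ε}) /
      (c * ε ^ (-p))) (nhdsWithin 0 (Ioi 0)) (nhds 1) := by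
  refine Tendsto.congr' ?_ h
  filter_upwards [self_mem_nhdsWithin] with ε (hε : 0 < ε)
  simp only [iSup_mem_Icc_le_iff (hZc _).abs (fun _ => abs_nonneg _) hε.le, Measure.real]

variable [IsProbabilityMeasure (ℙ : Measure Ω)]

lemma monotone_measureReal_forall_abs_le :
    Monotone fun r => (ℙ : Measure Ω).real {ω | ∀ t : Icc (0 : ℝ) 1, |Z t ω| ≤ r} :=
  fun _ _ hrs => measureReal_mono fun _ hω t => (hω t).trans hrs

lemma measureReal_le_of_le_nat_mul {S T : Set Ω} {n : ℕ} (h : ℙ S ≤ n * ℙ T) :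
    (ℙ : Measure Ω).real S ≤ n * (ℙ : Measure Ω).real T := by
  have := ENNReal.toReal_mono (ENNReal.mul_ne_top (by simp) (measure_ne_top _ _)) h
  simpa [Measure.real] using this

lemma exists_mul_exp_le_measureReal (hc : 0 < c)
    (hZ : Tendsto (fun ε => -Real.log ((ℙ : Measure Ω).real
      {ω | ∀ t : Icc (0 : ℝ) 1, |Z t ω| ≤ ε}) / (c * ε ^ (-(1 / H)))) (nhdsWithin 0 (Ioi 0)) (nhds 1))
    (hθ : 1 < θ) : ∃ C > 0, ∀ r > 0, C * Real.exp (-(θ * c * r ^ (-(1 / H)))) ≤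
      (ℙ : Measure Ω).real {ω | ∀ t : Icc (0 : ℝ) 1, |Z t ω| ≤ r} :=
  exists_mul_exp_le_of_tendsto monotone_measureReal_forall_abs_le (fun _ => measureReal_nonneg)
    (fun _ => measureReal_le_one) hc hZ hθ

lemma HasFBMFdds.exists_measureReal_oscillation_le (hY : HasFBMFdds H (Icc 0 1) Y)
    (hYc : ∀ ω, ContinuousOn (fun t => Y t ω) (Icc 0 1)) (hH : 0 < H) (hc : 0 < c)
    (hYt : Tendsto (fun ε => -Real.log ((ℙ : Measure Ω).real
      {ω | ∀ t : Icc (0 : ℝ) 1, |Y t ω| ≤ ε}) / (c * ε ^ (-(1 / H)))) (nhdsWithin 0 (Ioi 0)) (nhds 1))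
    (hθ0 : 0 < θ) (hθ : θ < 1) : ∃ C, 1 ≤ C ∧ ∀ r > 0,
      (ℙ : Measure Ω).real {ω | ∀ s t : Icc (0 : ℝ) 1, |Y s ω - Y t ω| ≤ 2 * r} ≤
        C * Real.exp (-(θ * c * r ^ (-(1 / H)))) := by
  obtain ⟨m, hm, C, hC, h⟩ := exists_mul_le_mul_exp (fun _ => measureReal_le_one) hc
    (one_div_pos.2 hH) hYt hθ0 hθ
  have hN : (1 : ℝ) ≤ (2 * m + 1 : ℕ) := by exact_mod_cast Nat.le_add_left 1 (2 * m)
  refine ⟨(2 * m + 1 : ℕ) * C, one_le_mul_of_one_le_of_one_le hN hC, fun r hr => ?_⟩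
  rw [mul_assoc]
  exact (measureReal_le_of_le_nat_mul (hY.measure_oscillation_le hYc hH hm hr)).trans
    (mul_le_mul_of_nonneg_left (h r hr) (by positivity))

lemma IsTrueFBM.exists_measureReal_interval_le (hX : IsTrueFBM H X)
    (hXc : ∀ ω, Continuous fun t => X t ω) (hH : 0 < H) (hc : 0 < c)
    (hXt : Tendsto (fun ε => -Real.log ((ℙ : Measure Ω).real
      {ω | ∀ t : Icc (0 : ℝ) 1, |X t ω| ≤ ε}) / (c * ε ^ (-(1 / H)))) (nhdsWithin 0 (Ioi 0)) (nhds 1))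
    (hθ0 : 0 < θ) (hθ : θ < 1) :
    ∃ C, 1 ≤ C ∧ ∀ a b ε : ℝ, 0 ≤ a → 0 ≤ b → 0 < ε →
      (ℙ : Measure Ω).real {ω | ∀ s ∈ Icc (-a) b, |X s ω| ≤ ε} ≤
        C * Real.exp (-(θ * c * (a + b) * ε ^ (-(1 / H)))) := by
  obtain ⟨m, hm, C, hC, h⟩ := exists_mul_le_mul_exp (fun _ => measureReal_le_one) hc
    (one_div_pos.2 hH) hXt hθ0 hθ
  have hN : (1 : ℝ) ≤ (2 * m + 1 : ℕ) := by exact_mod_cast Nat.le_add_left 1 (2 * m)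
  refine ⟨(2 * m + 1 : ℕ) * C, one_le_mul_of_one_le_of_one_le hN hC, fun a b ε ha hb hε => ?_⟩
  rcases (add_nonneg ha hb).eq_or_lt with hab | hab
  · rw [← hab]
    simp only [mul_zero, zero_mul, neg_zero, Real.exp_zero, mul_one]
    exact measureReal_le_one.trans (one_le_mul_of_one_le_of_one_le hN hC)
  · rw [mul_assoc]
    refine (measureReal_le_of_le_nat_mul (hX.measure_interval_le hXc hH hab hm hε)).trans
      (mul_le_mul_of_nonneg_left ?_ (by positivity))
    have := h (ε / (a + b) ^ H) (div_pos hε (Real.rpow_pos_of_pos hab H))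
    rwa [div_rpow_rpow_neg_inv hH hab hε, ← mul_assoc, ← mul_div_assoc] at this

lemma IsTrueFBM.exists_le_measureReal_interval (hX : IsTrueFBM H X)
    (hXc : ∀ ω, Continuous fun t => X t ω) (hH : 0 < H) (hc : 0 < c)
    (hXt : Tendsto (fun ε => -Real.log ((ℙ : Measure Ω).real
      {ω | ∀ t : Icc (0 : ℝ) 1, |X t ω| ≤ ε}) / (c * ε ^ (-(1 / H)))) (nhdsWithin 0 (Ioi 0)) (nhds 1))
    (hθ : 1 < θ) :
    ∃ C > 0, ∀ r ε : ℝ, 0 < r → 0 < ε →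
      C * Real.exp (-(θ * c * (r + r) * ε ^ (-(1 / H)))) ≤
        (ℙ : Measure Ω).real {ω | ∀ s ∈ Icc (-r) r, |X s ω| ≤ ε} := by
  obtain ⟨m, hm, C, hC, h⟩ := exists_mul_exp_le_div monotone_measureReal_forall_abs_le
    (fun _ => measureReal_nonneg) (fun _ => measureReal_le_one) hc hXt hθ
  have hN : (0 : ℝ) < (2 * m + 1 : ℕ) := by positivity
  have hm' : (0 : ℝ) < 1 + 1 / m := by positivity
  refine ⟨C / (2 * m + 1 : ℕ), div_pos hC hN, fun r ε hr hε => ?_⟩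
  have hrr : 0 < r + r := add_pos hr hr
  rw [div_mul_eq_mul_div, div_le_iff₀' hN]
  have h1 := h (ε / (r + r) ^ H) (div_pos hε (Real.rpow_pos_of_pos hrr H))
  rw [div_rpow_rpow_neg_inv hH hrr hε, ← mul_assoc, div_right_comm] at h1
  have h2 := measureReal_le_of_le_nat_mul
    (hX.le_measure_interval hXc hH hr.le hr.le hrr hm (div_pos hε hm'))
  rw [mul_div_cancel₀ _ hm'.ne'] at h2
  exact h1.trans h2

end Estimates

section Optimization

variable {H a c : ℝ}

lemma weighted_geom_mean_eq (hH : 0 < H) (ha : 0 < a) (hc : 0 < c) {r : ℝ} (hr : 0 < r) :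
    (H * a * r) ^ (1 / (1 + H)) * (c * r ^ (-(1 / H))) ^ (H / (1 + H)) =
      (c ^ H * (H * a)) ^ (1 / (1 + H)) := by
  have hr' := Real.rpow_pos_of_pos hr (-(1 / H))
  rw [Real.mul_rpow (by positivity) hr.le, Real.mul_rpow hc.le hr'.le,
    Real.mul_rpow (Real.rpow_pos_of_pos hc H).le (mul_pos hH ha).le, ← Real.rpow_mul hr.le, ← Real.rpow_mul hc.le,
    show -(1 / H) * (H / (1 + H)) = -(1 / (1 + H)) by field_simp, Real.rpow_neg hr.le,
    show H * (1 / (1 + H)) = H / (1 + H) by ring]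
  have := (Real.rpow_pos_of_pos hr (1 / (1 + H))).ne'
  field_simp

lemma le_linear_add_rpow_neg (hH : 0 < H) (ha : 0 < a) (hc : 0 < c) {r : ℝ} (hr : 0 < r) :
    (1 + 1 / H) * (c ^ H * (H * a)) ^ (1 / (1 + H)) ≤ a * r + c * r ^ (-(1 / H)) := by
  have hr' := Real.rpow_pos_of_pos hr (-(1 / H))
  have := Real.geom_mean_le_arith_mean2_weighted (w₁ := 1 / (1 + H)) (w₂ := H / (1 + H))
    (p₁ := H * a * r) (p₂ := c * r ^ (-(1 / H))) (by positivity) (by positivity) (by positivity)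
    (by positivity) (by rw [← add_div, div_self (by positivity)])
  rw [weighted_geom_mean_eq hH ha hc hr] at this
  calc (1 + 1 / H) * (c ^ H * (H * a)) ^ (1 / (1 + H))
      ≤ (1 + 1 / H) * (1 / (1 + H) * (H * a * r) + H / (1 + H) * (c * r ^ (-(1 / H)))) := by
        gcongr
    _ = a * r + c * r ^ (-(1 / H)) := by field_simp; ring

lemma exists_linear_add_rpow_neg_eq (hH : 0 < H) (ha : 0 < a) (hc : 0 < c) :
    ∃ r > 0, a * r + c * r ^ (-(1 / H)) = (1 + 1 / H) * (c ^ H * (H * a)) ^ (1 / (1 + H)) := by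
  have hq : 0 < c / (H * a) := by positivity
  have hr : 0 < (c / (H * a)) ^ (H / (1 + H)) := Real.rpow_pos_of_pos hq _
  refine ⟨_, hr, ?_⟩
  set r := (c / (H * a)) ^ (H / (1 + H)) with hr_def
  have hx : c * r ^ (-(1 / H)) = H * a * r := by
    have h1 : r * r ^ (1 / H) = c / (H * a) := by
      rw [← Real.rpow_one_add' hr.le (by positivity), hr_def, ← Real.rpow_mul hq.le,
        show H / (1 + H) * (1 + 1 / H) = 1 by field_simp; ring, Real.rpow_one]
    have h2 := Real.rpow_pos_of_pos hr (1 / H)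
    rw [Real.rpow_neg hr.le]
    field_simp at h1 ⊢
    linarith
  rw [← weighted_geom_mean_eq hH ha hc hr, hx,
    ← Real.rpow_add (by positivity), show 1 / (1 + H) + H / (1 + H) = 1 by
      rw [← add_div, div_self (by positivity)], Real.rpow_one]
  field_simp
  ring

end Optimization

lemma tendsto_div_one_of_forall_eventually {α : Type*} {l : Filter α} {f g : α → ℝ}
    (hg : ∀ᶠ x in l, 0 < g x) (h1 : ∀ θ > 1, ∀ᶠ x in l, f x ≤ θ * g x)
    (h2 : ∀ θ > 0, θ < 1 → ∀ᶠ x in l, θ * g x ≤ f x) :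
    Tendsto (fun x => f x / g x) l (nhds 1) := by
  refine tendsto_order.2 ⟨fun b hb => ?_, fun b hb => ?_⟩
  · obtain ⟨θ, hθ, hθ1⟩ := exists_between (max_lt hb one_pos)
    filter_upwards [hg, h2 θ ((le_max_right _ _).trans_lt hθ) hθ1] with x hx hfx
    exact ((le_max_left _ _).trans_lt hθ).trans_le ((le_div_iff₀ hx).2 hfx)
  · obtain ⟨θ, hθ, hθb⟩ := exists_between hb
    filter_upwards [hg, h1 θ hθ] with x hx hfx
    exact ((div_le_iff₀ hx).2 hfx).trans_lt hθb

lemma exists_measurableSet_forall_abs_le_eq_preimage {T E Ω : Type*} [TopologicalSpace T]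
    [TopologicalSpace.SeparableSpace T] [Nonempty T] [MeasurableSpace E] {F : T → E → ℝ}
    (hF : ∀ t, Measurable (F t)) {U : Ω → E} (hU : ∀ ω, Continuous fun t => F t (U ω)) (r : ℝ) :
    ∃ S, MeasurableSet S ∧ {ω | ∀ t, |F t (U ω)| ≤ r} = U ⁻¹' S := by
  obtain ⟨d, hd⟩ := TopologicalSpace.exists_dense_seq T
  refine ⟨⋂ k, {x | |F (d k) x| ≤ r},
    MeasurableSet.iInter fun k => measurableSet_le (hF _).abs measurable_const, ?_⟩
  ext ω
  simpa using hd.forall_abs_le_iff (hU ω)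

section Composition

variable {H₁ H₂ c₁ c₂ θ : ℝ} {X Y : ℝ → Ω → ℝ}

lemma exists_measurableSet_interval_eq_preimage {Ω : Type*} {X : ℝ → Ω → ℝ}
    (hXc : ∀ ω, Continuous fun t => X t ω)
    {a b : ℝ} (ha : 0 ≤ a) (hb : 0 ≤ b) (ε : ℝ) : ∃ S, MeasurableSet S ∧
      {ω | ∀ s ∈ Icc (-a) b, |X s ω| ≤ ε} = (fun ω => fun t : ℝ => X t ω) ⁻¹' S := by
  have : Nonempty (Icc (-a) b) := ⟨⟨0, by simpa using ha, hb⟩⟩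
  obtain ⟨S, hS, h⟩ := exists_measurableSet_forall_abs_le_eq_preimage
    (F := fun (t : Icc (-a) b) (x : ℝ → ℝ) => x t) (fun t => measurable_pi_apply _)
    (U := fun ω t => X t ω) (fun ω => (hXc ω).comp continuous_subtype_val) ε
  exact ⟨S, hS, by rw [← h]; simp⟩

lemma measureReal_inter_sup (hXc : ∀ ω, Continuous fun t => X t ω)
    (hYc : ∀ ω, ContinuousOn (fun t => Y t ω) (Icc 0 1))
    (hXY : IndepFun (fun ω => fun t : ℝ => X t ω) (fun ω => fun t : Icc (0 : ℝ) 1 => Y t.1 ω) ℙ)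
    {a b : ℝ} (ha : 0 ≤ a) (hb : 0 ≤ b) (ε r : ℝ) :
    (ℙ : Measure Ω).real ({ω | ∀ s ∈ Icc (-a) b, |X s ω| ≤ ε} ∩
      {ω | ∀ t : Icc (0 : ℝ) 1, |Y t ω| ≤ r}) =
    (ℙ : Measure Ω).real {ω | ∀ s ∈ Icc (-a) b, |X s ω| ≤ ε} *
      (ℙ : Measure Ω).real {ω | ∀ t : Icc (0 : ℝ) 1, |Y t ω| ≤ r} := by
  obtain ⟨S, hS, h⟩ := exists_measurableSet_interval_eq_preimage hXc ha hb ε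
  obtain ⟨S', hS', h'⟩ := exists_measurableSet_forall_abs_le_eq_preimage
    (F := fun (t : Icc (0 : ℝ) 1) (y : Icc (0 : ℝ) 1 → ℝ) => y t) (fun t => measurable_pi_apply _)
    (U := fun ω t => Y t.1 ω) (fun ω => continuousOn_iff_continuous_domRestrict.1 (hYc ω)) r
  rw [h, h']
  simp only [Measure.real, hXY.measure_inter_preimage_eq_mul _ _ hS hS', ENNReal.toReal_mul]

lemma measureReal_inter_oscillation (hXc : ∀ ω, Continuous fun t => X t ω)
    (hYc : ∀ ω, ContinuousOn (fun t => Y t ω) (Icc 0 1))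
    (hXY : IndepFun (fun ω => fun t : ℝ => X t ω) (fun ω => fun t : Icc (0 : ℝ) 1 => Y t.1 ω) ℙ)
    {a b : ℝ} (ha : 0 ≤ a) (hb : 0 ≤ b) (ε r : ℝ) :
    (ℙ : Measure Ω).real ({ω | ∀ s ∈ Icc (-a) b, |X s ω| ≤ ε} ∩
      {ω | ∀ s t : Icc (0 : ℝ) 1, |Y s ω - Y t ω| ≤ r}) =
    (ℙ : Measure Ω).real {ω | ∀ s ∈ Icc (-a) b, |X s ω| ≤ ε} *
      (ℙ : Measure Ω).real {ω | ∀ s t : Icc (0 : ℝ) 1, |Y s ω - Y t ω| ≤ r} := by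
  obtain ⟨S, hS, h⟩ := exists_measurableSet_interval_eq_preimage hXc ha hb ε
  have hYc' := fun ω => continuousOn_iff_continuous_domRestrict.1 (hYc ω)
  obtain ⟨S', hS', h'⟩ := exists_measurableSet_forall_abs_le_eq_preimage
    (F := fun (t : Icc (0 : ℝ) 1 × Icc (0 : ℝ) 1) (y : Icc (0 : ℝ) 1 → ℝ) => y t.1 - y t.2)
    (fun t => (measurable_pi_apply _).sub (measurable_pi_apply _)) (U := fun ω t => Y t.1 ω)
    (fun ω => ((hYc' ω).comp continuous_fst).sub ((hYc' ω).comp continuous_snd)) r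
  simp only [Prod.forall] at h'
  rw [h, h']
  simp only [Measure.real, hXY.measure_inter_preimage_eq_mul _ _ hS hS', ENNReal.toReal_mul]

/-- If a path of `Y` starts at `0`, then either its range sticks out of `(-1, 1)`, or the range is
determined up to the mesh `1 / n`. -/
lemma mem_iUnion_of_forall_abs_comp_le {x y : ℝ → ℝ} (hy : ContinuousOn y (Icc 0 1))
    (hy0 : y 0 = 0) {ε : ℝ} (h : ∀ t : Icc (0 : ℝ) 1, |x (y t)| ≤ ε) {n : ℕ} (hn : 0 < n) :
    (∀ s ∈ Icc (-1) 0, |x s| ≤ ε) ∨ (∀ s ∈ Icc (-0) 1, |x s| ≤ ε) ∨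
    ∃ i < n, ∃ j < n, (∀ s ∈ Icc (-(i / n : ℝ)) (j / n), |x s| ≤ ε) ∧
      ∀ s t : Icc (0 : ℝ) 1, |y s - y t| ≤ 2 * ((i + j + 2) / (2 * n)) := by
  obtain ⟨p, hpI, hp⟩ := isCompact_Icc.exists_isMinOn (nonempty_Icc.2 zero_le_one) hy
  obtain ⟨q, hqI, hq⟩ := isCompact_Icc.exists_isMaxOn (nonempty_Icc.2 zero_le_one) hy
  have hmem : (0 : ℝ) ∈ Icc (0 : ℝ) 1 := by simp
  have hp0 : y p ≤ 0 := hy0 ▸ hp hmem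
  have hq0 : 0 ≤ y q := hy0 ▸ hq hmem
  have hx : ∀ s ∈ Icc (y p) (y q), |x s| ≤ ε := by
    intro s hs
    obtain ⟨t, ht, rfl⟩ := isPreconnected_Icc.intermediate_value hpI hqI hy hs
    exact h ⟨t, ht⟩
  rcases le_or_gt (y p) (-1) with hp1 | hp1
  · exact Or.inl fun s hs => hx s ⟨hp1.trans hs.1, hs.2.trans hq0⟩
  rcases le_or_gt 1 (y q) with hq1 | hq1
  · exact Or.inr (Or.inl fun s hs => hx s ⟨hp0.trans (by simpa using hs.1), hs.2.trans hq1⟩)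
  have hn' : (0 : ℝ) < n := by exact_mod_cast hn
  have hpn : 0 ≤ -y p * n := by nlinarith
  have hqn : 0 ≤ y q * n := by nlinarith
  refine Or.inr (Or.inr ⟨⌊-y p * n⌋₊, (Nat.floor_lt hpn).2 (by nlinarith), ⌊y q * n⌋₊,
    (Nat.floor_lt hqn).2 (by nlinarith), fun s hs => hx s ⟨?_, ?_⟩, fun s t => ?_⟩)
  · have := (div_le_iff₀ hn').2 (Nat.floor_le hpn)
    linarith [hs.1]
  · exact hs.2.trans ((div_le_iff₀ hn').2 (Nat.floor_le hqn))
  · have h1 := Nat.lt_floor_add_one (-y p * n)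
    have h2 := Nat.lt_floor_add_one (y q * n)
    have h3 : y q - y p ≤ 2 * (((⌊-y p * n⌋₊ : ℝ) + ⌊y q * n⌋₊ + 2) / (2 * n)) := by
      rw [← mul_div_assoc, mul_div_mul_left _ _ two_ne_zero, le_div_iff₀ hn']
      linarith
    have hs1 : y p ≤ y s := hp s.2
    have hs2 : y s ≤ y q := hq s.2
    have ht1 : y p ≤ y t := hp t.2
    have ht2 : y t ≤ y q := hq t.2
    rw [abs_le]
    constructor <;> linarith

variable [IsProbabilityMeasure (ℙ : Measure Ω)]

lemma le_measureReal_comp (hXc : ∀ ω, Continuous fun t => X t ω)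
    (hYc : ∀ ω, ContinuousOn (fun t => Y t ω) (Icc 0 1))
    (hXY : IndepFun (fun ω => fun t : ℝ => X t ω) (fun ω => fun t : Icc (0 : ℝ) 1 => Y t.1 ω) ℙ)
    (ε : ℝ) {r : ℝ} (hr : 0 ≤ r) :
    (ℙ : Measure Ω).real {ω | ∀ s ∈ Icc (-r) r, |X s ω| ≤ ε} *
      (ℙ : Measure Ω).real {ω | ∀ t : Icc (0 : ℝ) 1, |Y t ω| ≤ r} ≤
    (ℙ : Measure Ω).real {ω | ∀ t : Icc (0 : ℝ) 1, |X (Y t ω) ω| ≤ ε} := by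
  rw [← measureReal_inter_sup hXc hYc hXY hr hr]
  exact measureReal_mono fun ω hω t => hω.1 _ (abs_le.1 (hω.2 t))

lemma measureReal_comp_le_sum (hXc : ∀ ω, Continuous fun t => X t ω)
    (hYc : ∀ ω, ContinuousOn (fun t => Y t ω) (Icc 0 1)) (hY0 : ∀ᵐ ω, Y 0 ω = 0)
    (hXY : IndepFun (fun ω => fun t : ℝ => X t ω) (fun ω => fun t : Icc (0 : ℝ) 1 => Y t.1 ω) ℙ)
    (ε : ℝ) {n : ℕ} (hn : 0 < n) :
    (ℙ : Measure Ω).real {ω | ∀ t : Icc (0 : ℝ) 1, |X (Y t ω) ω| ≤ ε} ≤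
      (ℙ : Measure Ω).real {ω | ∀ s ∈ Icc (-1) 0, |X s ω| ≤ ε} +
      (ℙ : Measure Ω).real {ω | ∀ s ∈ Icc (-0) 1, |X s ω| ≤ ε} +
      ∑ i ∈ Finset.range n, ∑ j ∈ Finset.range n,
        (ℙ : Measure Ω).real {ω | ∀ s ∈ Icc (-(i / n : ℝ)) (j / n), |X s ω| ≤ ε} *
        (ℙ : Measure Ω).real
          {ω | ∀ s t : Icc (0 : ℝ) 1, |Y s ω - Y t ω| ≤ 2 * ((i + j + 2) / (2 * n))} := by
  have hsub : {ω | ∀ t : Icc (0 : ℝ) 1, |X (Y t ω) ω| ≤ ε} ≤ᵐ[ℙ]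
      (({ω | ∀ s ∈ Icc (-1) 0, |X s ω| ≤ ε} ∪ {ω | ∀ s ∈ Icc (-0) 1, |X s ω| ≤ ε}) ∪
      ⋃ i ∈ Finset.range n, ⋃ j ∈ Finset.range n,
        ({ω | ∀ s ∈ Icc (-(i / n : ℝ)) (j / n), |X s ω| ≤ ε} ∩
          {ω | ∀ s t : Icc (0 : ℝ) 1, |Y s ω - Y t ω| ≤ 2 * ((i + j + 2) / (2 * n))}) :
            Set Ω) := by
    filter_upwards [hY0] with ω hω h
    rcases mem_iUnion_of_forall_abs_comp_le (x := fun s => X s ω) (hYc ω) hω h hn with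
      h1 | h1 | ⟨i, hi, j, hj, h1⟩
    · exact Or.inl (Or.inl h1)
    · exact Or.inl (Or.inr h1)
    · refine Or.inr ?_
      simp only [mem_iUnion, Finset.mem_range]
      exact ⟨i, hi, j, hj, h1⟩
  refine (ENNReal.toReal_mono (measure_ne_top _ _) (measure_mono_ae hsub)).trans ?_
  refine (measureReal_union_le _ _).trans (add_le_add (measureReal_union_le _ _) ?_)
  refine (measureReal_biUnion_finset_le _ _).trans (Finset.sum_le_sum fun i _ => ?_)
  refine (measureReal_biUnion_finset_le _ _).trans (Finset.sum_le_sum fun j _ => ?_)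
  exact (measureReal_inter_oscillation hXc hYc hXY (by positivity) (by positivity) _ _).le

lemma exists_measureReal_comp_le (hXc : ∀ ω, Continuous fun t => X t ω)
    (hYc : ∀ ω, ContinuousOn (fun t => Y t ω) (Icc 0 1)) (hY0 : ∀ᵐ ω, Y 0 ω = 0)
    (hXY : IndepFun (fun ω => fun t : ℝ => X t ω) (fun ω => fun t : Icc (0 : ℝ) 1 => Y t.1 ω) ℙ)
    (hH₁ : 0 < H₁) (hc₁ : 0 < c₁) (hc₂ : 0 < c₂) (hθ : 0 < θ) {C D : ℝ} (hC : 1 ≤ C) (hD : 1 ≤ D)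
    (hX : ∀ a b ε : ℝ, 0 ≤ a → 0 ≤ b → 0 < ε →
      (ℙ : Measure Ω).real {ω | ∀ s ∈ Icc (-a) b, |X s ω| ≤ ε} ≤
        C * Real.exp (-(θ * c₂ * (a + b) * ε ^ (-(1 / H₂)))))
    (hY : ∀ r > 0, (ℙ : Measure Ω).real {ω | ∀ s t : Icc (0 : ℝ) 1, |Y s ω - Y t ω| ≤ 2 * r} ≤
        D * Real.exp (-(θ * c₁ * r ^ (-(1 / H₁))))) :
    ∃ K > 0, ∀ ε > 0, (ℙ : Measure Ω).real {ω | ∀ t : Icc (0 : ℝ) 1, |X (Y t ω) ω| ≤ ε} ≤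
      K * ((⌈ε ^ (-(1 / H₂))⌉₊ : ℝ) ^ 2 + 2) * Real.exp (-(θ * ((1 + 1 / H₁) *
        (c₁ ^ H₁ * (H₁ * (2 * c₂ * ε ^ (-(1 / H₂))))) ^ (1 / (1 + H₁))))) := by
  have hC0 : 0 < C := by linarith
  have hD0 : 0 < D := by linarith
  refine ⟨C * Real.exp (θ * (c₁ * (1 / 2) ^ (-(1 / H₁)))) + C * D * Real.exp (2 * θ * c₂),
    by positivity, fun ε hε => ?_⟩
  have hL : 0 < ε ^ (-(1 / H₂)) := Real.rpow_pos_of_pos hε _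
  set L := ε ^ (-(1 / H₂)) with hL_def
  set g := (1 + 1 / H₁) * (c₁ ^ H₁ * (H₁ * (2 * c₂ * L))) ^ (1 / (1 + H₁)) with hg
  have hgle : ∀ r > 0, g ≤ 2 * c₂ * L * r + c₁ * r ^ (-(1 / H₁)) := fun r hr =>
    le_linear_add_rpow_neg hH₁ (by positivity) hc₁ hr
  have hn : 0 < ⌈L⌉₊ := Nat.ceil_pos.2 hL
  have hLn : L ≤ ⌈L⌉₊ := Nat.le_ceil L
  set n := ⌈L⌉₊
  have hn' : (0 : ℝ) < n := by exact_mod_cast hn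
  have htail : C * Real.exp (-(θ * c₂ * 1 * L)) ≤
      C * Real.exp (θ * (c₁ * (1 / 2) ^ (-(1 / H₁)))) * Real.exp (-(θ * g)) := by
    rw [mul_assoc C, ← Real.exp_add]
    gcongr
    nlinarith [hgle (1 / 2) (by norm_num)]
  have hterm : ∀ i ∈ Finset.range n, ∀ j ∈ Finset.range n,
      (ℙ : Measure Ω).real {ω | ∀ s ∈ Icc (-(i / n : ℝ)) (j / n), |X s ω| ≤ ε} *
      (ℙ : Measure Ω).real
        {ω | ∀ s t : Icc (0 : ℝ) 1, |Y s ω - Y t ω| ≤ 2 * ((i + j + 2) / (2 * n))} ≤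
      C * D * Real.exp (2 * θ * c₂) * Real.exp (-(θ * g)) := by
    intro i _ j _
    set r : ℝ := (i + j + 2) / (2 * n) with hr_def
    have hr : 0 < r := by positivity
    have hLdiv : L / n ≤ 1 := (div_le_one hn').2 hLn
    have hij : ((i : ℝ) / n + j / n) * L = 2 * L * r - 2 * (L / n) := by
      rw [hr_def]; field_simp; ring
    refine (mul_le_mul (hX _ _ ε (by positivity) (by positivity) hε) (hY r hr) measureReal_nonneg
      (by positivity)).trans ?_
    rw [mul_mul_mul_comm, mul_assoc (C * D), ← Real.exp_add, ← Real.exp_add]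
    refine mul_le_mul_of_nonneg_left (Real.exp_le_exp.2 ?_) (by positivity)
    rw [mul_assoc _ _ L, hij]
    have h1 := mul_le_mul_of_nonneg_left (hgle r hr) hθ.le
    have h2 := mul_le_mul_of_nonneg_left hLdiv (mul_pos hθ hc₂).le
    nlinarith
  have hsum := measureReal_comp_le_sum hXc hYc hY0 hXY ε hn
  have h1 := hX 1 0 ε zero_le_one le_rfl hε
  have h2 := hX 0 1 ε le_rfl zero_le_one hε
  rw [add_zero] at h1
  rw [zero_add] at h2
  have h3 := Finset.sum_le_sum fun i hi => Finset.sum_le_sum fun j hj => hterm i hi j hj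
  simp only [Finset.sum_const, Finset.card_range, nsmul_eq_mul] at h3
  refine hsum.trans ((add_le_add (add_le_add (h1.trans htail) (h2.trans htail)) h3).trans ?_)
  have p1 : 0 ≤ C * Real.exp (θ * (c₁ * (1 / 2) ^ (-(1 / H₁)))) * Real.exp (-(θ * g)) := by
    positivity
  have p2 : 0 ≤ C * D * Real.exp (2 * θ * c₂) * Real.exp (-(θ * g)) := by positivity
  nlinarith [mul_nonneg (sq_nonneg (n : ℝ)) p1]

end Composition

lemma eventually_le_mul_rpow (k : ℝ) {δ b : ℝ} (hδ : 0 < δ) (hb : 0 < b) :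
    ∀ᶠ x : ℝ in atTop, k ≤ δ * x ^ b :=
  ((tendsto_rpow_atTop hb).const_mul_atTop hδ).eventually_ge_atTop k

lemma eventually_log_mul_ceil_sq_le {K δ b : ℝ} (hK : 0 < K) (hδ : 0 < δ) (hb : 0 < b) :
    ∀ᶠ x : ℝ in atTop, Real.log (K * ((⌈x⌉₊ : ℝ) ^ 2 + 2)) ≤ δ * x ^ b := by
  have hlog := (isLittleO_log_rpow_atTop hb).def (show 0 < δ / 4 by positivity)
  filter_upwards [hlog, eventually_le_mul_rpow (Real.log (6 * K)) (half_pos hδ) hb,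
    eventually_ge_atTop 1] with x h1 h2 hx
  have hx0 : 0 < x := by linarith
  have hn : (⌈x⌉₊ : ℝ) ≤ 2 * x := by linarith [Nat.ceil_lt_add_one hx0.le]
  rw [Real.norm_of_nonneg (Real.log_nonneg hx),
    Real.norm_of_nonneg (Real.rpow_pos_of_pos hx0 b).le] at h1
  calc Real.log (K * ((⌈x⌉₊ : ℝ) ^ 2 + 2)) ≤ Real.log (6 * K * x ^ 2) := by
        have hsq : (⌈x⌉₊ : ℝ) ^ 2 ≤ (2 * x) ^ 2 := by gcongr
        have hle : (⌈x⌉₊ : ℝ) ^ 2 + 2 ≤ 6 * x ^ 2 := by nlinarith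
        refine Real.log_le_log (by positivity) ((mul_le_mul_of_nonneg_left hle hK.le).trans_eq ?_)
        ring
    _ = Real.log (6 * K) + 2 * Real.log x := by
        rw [Real.log_mul (by positivity) (by positivity), Real.log_pow]
        norm_num
    _ ≤ δ * x ^ b := by linarith

theorem statement10 [IsProbabilityMeasure (ℙ : Measure Ω)]
    (H₁ H₂ : ℝ) (hH₁ : H₁ ∈ Set.Ioo (0:ℝ) 1) (hH₂ : H₂ ∈ Set.Ioo (0:ℝ) 1)
    (X Y : ℝ → Ω → ℝ)
    (hX : IsTrueFBM H₂ X)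
    (hXcont : ∀ ω, Continuous fun t => X t ω)
    (hY : HasFBMFdds H₁ (Set.Icc 0 1) Y)
    (hYcont : ∀ ω, ContinuousOn (fun t => Y t ω) (Set.Icc 0 1))
    (hIndep : IndepFun (fun ω => fun t : ℝ => X t ω)
      (fun ω => fun t : Set.Icc (0:ℝ) 1 => Y t.1 ω) ℙ)
    (c₁ c₂ : ℝ) (hc₁ : 0 < c₁) (hc₂ : 0 < c₂)
    (hYsd : strongEquiv
      (fun ε => -Real.log ((ℙ {ω | ⨆ t ∈ Set.Icc (0:ℝ) 1, |Y t ω| ≤ ε}).toReal))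
      (fun ε => c₁ * ε ^ (-(1/H₁))))
    (hXsd : strongEquiv
      (fun ε => -Real.log ((ℙ {ω | ⨆ t ∈ Set.Icc (0:ℝ) 1, |X t ω| ≤ ε}).toReal))
      (fun ε => c₂ * ε ^ (-(1/H₂)))) :
    strongEquiv
      (fun ε => -Real.log ((ℙ {ω | ⨆ t ∈ Set.Icc (0:ℝ) 1, |X (Y t ω) ω| ≤ ε}).toReal))
      (fun ε => (1 + 1/H₁) * (c₁ ^ H₁ * (2 * H₁ * c₂)) ^ (1/(1+H₁)) *
        ε ^ (-(1 / (H₂ * (1 + H₁))))) := by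
  have h1 : 0 < H₁ := hH₁.1
  have h2 : 0 < H₂ := hH₂.1
  have hYt := hYsd.tendsto_measureReal hYcont
  have hXt := hXsd.tendsto_measureReal fun ω => (hXcont ω).continuousOn
  have hY0 := hY.ae_zero h1
  have hb : 0 < 1 / (1 + H₁) := by positivity
  set A := (1 + 1 / H₁) * (c₁ ^ H₁ * (2 * H₁ * c₂)) ^ (1 / (1 + H₁)) with hA_def
  have hA : 0 < A := by positivity
  have hg : ∀ ε > 0, A * ε ^ (-(1 / (H₂ * (1 + H₁)))) =
      A * (ε ^ (-(1 / H₂))) ^ (1 / (1 + H₁)) := fun ε hε => by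
    rw [← Real.rpow_mul (le_of_lt hε)]
    congr 2
    field_simp
  have hM : ∀ L > 0, (1 + 1 / H₁) * (c₁ ^ H₁ * (H₁ * (2 * c₂ * L))) ^ (1 / (1 + H₁)) =
      A * L ^ (1 / (1 + H₁)) := fun L hL => by
    rw [hA_def, mul_assoc (1 + 1 / H₁), ← Real.mul_rpow (by positivity) (le_of_lt hL)]
    congr 2
    ring
  have hE : ∀ ε > 0, (ℙ {ω | ⨆ t ∈ Icc (0 : ℝ) 1, |X (Y t ω) ω| ≤ ε}).toReal =
      (ℙ : Measure Ω).real {ω | ∀ t : Icc (0 : ℝ) 1, |X (Y t ω) ω| ≤ ε} := fun ε hε => by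
    have hc : ∀ ω, ContinuousOn (fun t => |X (Y t ω) ω|) (Icc 0 1) := fun ω =>
      ((hXcont ω).comp_continuousOn (hYcont ω)).abs
    simp only [iSup_mem_Icc_le_iff (hc _) (fun _ => abs_nonneg _) (le_of_lt hε), Measure.real]
  have hLlim : Tendsto (fun ε : ℝ => ε ^ (-(1 / H₂))) (nhdsWithin 0 (Ioi 0)) atTop :=
    tendsto_rpow_neg_nhdsGT_zero (by simpa using h2)
  have hlower : ∀ θ > 1, ∃ C > 0, ∀ ε > 0,
      C * Real.exp (-(θ * (A * (ε ^ (-(1 / H₂))) ^ (1 / (1 + H₁))))) ≤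
        (ℙ : Measure Ω).real {ω | ∀ t : Icc (0 : ℝ) 1, |X (Y t ω) ω| ≤ ε} := by
    intro θ hθ
    obtain ⟨C, hC, hCX⟩ := hX.exists_le_measureReal_interval hXcont h2 hc₂ hXt hθ
    obtain ⟨D, hD, hDY⟩ := exists_mul_exp_le_measureReal hc₁ hYt hθ
    refine ⟨C * D, mul_pos hC hD, fun ε hε => ?_⟩
    have hL : 0 < ε ^ (-(1 / H₂)) := Real.rpow_pos_of_pos hε _
    obtain ⟨r, hr, hopt⟩ := exists_linear_add_rpow_neg_eq h1
      (show 0 < 2 * c₂ * ε ^ (-(1 / H₂)) by positivity) hc₁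
    rw [hM _ hL] at hopt
    refine le_trans (le_of_eq ?_) ((mul_le_mul (hCX r ε hr hε) (hDY r hr) (by positivity)
      measureReal_nonneg).trans (le_measureReal_comp hXcont hYcont hIndep ε (le_of_lt hr)))
    rw [← hopt, mul_mul_mul_comm, ← Real.exp_add]
    congr 2
    ring
  refine tendsto_div_one_of_forall_eventually ?_ (fun θ hθ => ?_) fun θ hθ0 hθ1 => ?_
  · filter_upwards [self_mem_nhdsWithin] with ε (hε : 0 < ε)
    exact mul_pos hA (Real.rpow_pos_of_pos hε _)
  · obtain ⟨θ', h1θ, hθθ⟩ := exists_between hθ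
    obtain ⟨C, hC, hP⟩ := hlower θ' h1θ
    filter_upwards [self_mem_nhdsWithin, hLlim.eventually (eventually_le_mul_rpow (-Real.log C)
      (mul_pos (sub_pos.2 hθθ) hA) hb)] with ε (hε : 0 < ε) hev
    have hlog := Real.log_le_log (by positivity) (hP ε hε)
    rw [Real.log_mul hC.ne' (Real.exp_pos _).ne', Real.log_exp] at hlog
    rw [hE ε hε, hg ε hε]
    linarith
  · obtain ⟨θ', h1θ, hθθ⟩ := exists_between hθ1
    have hθ0' := hθ0.trans h1θ
    obtain ⟨C, hC, hCX⟩ := hX.exists_measureReal_interval_le hXcont h2 hc₂ hXt hθ0' hθθ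
    obtain ⟨D, hD, hDY⟩ := hY.exists_measureReal_oscillation_le hYcont h1 hc₁ hYt hθ0' hθθ
    obtain ⟨K, hK, hP⟩ := exists_measureReal_comp_le hXcont hYcont hY0 hIndep h1 hc₁ hc₂ hθ0'
      hC hD hCX hDY
    obtain ⟨C', hC', hpos⟩ := hlower 2 one_lt_two
    filter_upwards [self_mem_nhdsWithin, hLlim.eventually (eventually_log_mul_ceil_sq_le hK
      (mul_pos (sub_pos.2 h1θ) hA) hb)] with ε (hε : 0 < ε) hev
    have hL : 0 < ε ^ (-(1 / H₂)) := Real.rpow_pos_of_pos hε _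
    have hlog := Real.log_le_log ((by positivity : (0 : ℝ) < _).trans_le (hpos ε hε)) (hP ε hε)
    rw [Real.log_mul (by positivity) (Real.exp_pos _).ne', Real.log_exp, hM _ hL] at hlog
    rw [hE ε hε, hg ε hε]
    linarith
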